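/- arXiv:0809.1182 — 9 statements merged into one kernel-verified Lean document; each statement's English description precedes it below -/
import Mathlib

section
/- A linear map J : ℝ³ → ℝ³ has zero torsion with respect to the cross-product Lie bracket if and only if there exist R ∈ SO(3) and ξ ∈ ℝ such that R⁻¹ J R is the matrix with rows (0,1,0), (−1,0,0), (0,0,ξ). -/
/-- The cross product on ℝ³ (the Lie bracket of su(2)). -/
def cross (x y : Fin 3 → ℝ) : Fin 3 → ℝ :=
  ![x 1 * y 2 - x 2 * y 1, x 2 * y 0 - x 0 * y 2, x 0 * y 1 - x 1 * y 0]

/-- `R` is a special orthogonal 3×3 matrix. -/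
def so3 (R : Matrix (Fin 3) (Fin 3) ℝ) : Prop := R * R.transpose = 1 ∧ R.det = 1

/-- `J` has zero torsion with respect to the cross-product Lie bracket on ℝ³. -/
def torsion3 (J : Matrix (Fin 3) (Fin 3) ℝ) : Prop :=
  ∀ X Y : Fin 3 → ℝ,
    cross (J.mulVec X) (J.mulVec Y) - cross X Y
      - J.mulVec (cross (J.mulVec X) Y) - J.mulVec (cross X (J.mulVec Y)) = 0

/-- The matrix of `v ↦ t ⟨n, v⟩ n - n × v`. -/
def axialMatrix (t : ℝ) (n : Fin 3 → ℝ) : Matrix (Fin 3) (Fin 3) ℝ :=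
  !![t * n 0 * n 0, t * n 0 * n 1 + n 2, t * n 0 * n 2 - n 1;
     t * n 1 * n 0 - n 2, t * n 1 * n 1, t * n 1 * n 2 + n 0;
     t * n 2 * n 0 + n 1, t * n 2 * n 1 - n 0, t * n 2 * n 2]

theorem mulVec_fin_three {R : Type*} [NonUnitalNonAssocSemiring R]
    (M : Matrix (Fin 3) (Fin 3) R) (v : Fin 3 → R) :
    M.mulVec v = ![M 0 0 * v 0 + M 0 1 * v 1 + M 0 2 * v 2,
      M 1 0 * v 0 + M 1 1 * v 1 + M 1 2 * v 2,
      M 2 0 * v 0 + M 2 1 * v 1 + M 2 2 * v 2] := by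
  ext i
  fin_cases i <;> simp [Matrix.mulVec, dotProduct, Fin.sum_univ_three]

theorem torsion3_axialMatrix (t : ℝ) (n : Fin 3 → ℝ)
    (hn : n 0 ^ 2 + n 1 ^ 2 + n 2 ^ 2 = 1) : torsion3 (axialMatrix t n) := by
  intro X Y
  unfold axialMatrix
  generalize n 0 = a at *
  generalize n 1 = b at *
  generalize n 2 = c at *
  ext i
  fin_cases i <;> simp only [cross, mulVec_fin_three] <;> simp <;> grind

/-- A symmetric `S` and an antisymmetric `A` with `S * S - S * A = t • S + c • 1`
satisfy `S * A = 0`. -/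
theorem mul_eq_zero_of_symm_of_antisymm {ι : Type*} [Fintype ι] [DecidableEq ι]
    (S A : Matrix ι ι ℝ) (t c : ℝ)
    (hS : S.transpose = S) (hA : A.transpose = -A)
    (h : S * S - S * A = t • S + c • (1 : Matrix ι ι ℝ)) : S * A = 0 := by
  have hT : S * S + A * S = t • S + c • (1 : Matrix ι ι ℝ) := by
    have := congrArg Matrix.transpose h
    simpa [Matrix.transpose_sub, Matrix.transpose_mul, hS, hA] using this
  have hanti : A * S = -(S * A) := by
    have := hT.trans h.symm
    rw [sub_eq_add_neg] at this
    exact add_left_cancel this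
  have hSA : S * A = S * S - t • S - c • (1 : Matrix ι ι ℝ) := by
    rw [sub_sub, ← h]; abel
  have hcomm : S * (S * A) = S * A * S := by
    rw [hSA]; simp [mul_sub, sub_mul, mul_assoc]
  have hSSA : S * (S * A) = 0 := by
    have h2 : S * (S * A) = -(S * (S * A)) := by
      conv_lhs => rw [hcomm, mul_assoc, hanti, mul_neg]
    ext i j
    have h3 := congrFun (congrFun h2 i) j
    rw [Matrix.neg_apply] at h3
    rw [Matrix.zero_apply]
    linarith
  have hzero : (S * A).conjTranspose * (S * A) = 0 := by
    rw [Matrix.conjTranspose_eq_transpose_of_trivial, Matrix.transpose_mul, hS, hA, mul_assoc,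
      hSSA, mul_zero]
  exact Matrix.conjTranspose_mul_self_eq_zero.mp hzero

theorem eq_axialMatrix_of_torsion3 (J : Matrix (Fin 3) (Fin 3) ℝ) (hJ : torsion3 J) :
    ∃ (t : ℝ) (n : Fin 3 → ℝ), n 0 ^ 2 + n 1 ^ 2 + n 2 ^ 2 = 1 ∧ J = axialMatrix t n := by
  obtain ⟨p, q, r, x, y, z, a, b, c, rfl⟩ : ∃ p q r x y z a b c : ℝ,
      J = !![p, x + c, y - b; x - c, q, z + a; y + b, z - a, r] := by
    refine ⟨J 0 0, J 1 1, J 2 2, (J 0 1 + J 1 0) / 2, (J 0 2 + J 2 0) / 2, (J 1 2 + J 2 1) / 2,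
      (J 1 2 - J 2 1) / 2, (J 2 0 - J 0 2) / 2, (J 0 1 - J 1 0) / 2, ?_⟩
    ext i j
    fin_cases i <;> fin_cases j <;> simp <;> ring
  have h01 := hJ ![1, 0, 0] ![0, 1, 0]
  have h12 := hJ ![0, 1, 0] ![0, 0, 1]
  have h20 := hJ ![0, 0, 1] ![1, 0, 0]
  have e00 := congrFun h12 0
  have e10 := congrFun h12 1
  have e20 := congrFun h12 2
  have e01 := congrFun h20 0
  have e11 := congrFun h20 1
  have e21 := congrFun h20 2
  have e02 := congrFun h01 0
  have e12 := congrFun h01 1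
  have e22 := congrFun h01 2
  clear h01 h12 h20 hJ
  simp only [cross, mulVec_fin_three] at e00 e10 e20 e01 e11 e21 e02 e12 e22
  simp at e00 e10 e20 e01 e11 e21 e02 e12 e22
  have hSA := mul_eq_zero_of_symm_of_antisymm !![p, x, y; x, q, z; y, z, r]
    !![0, c, -b; -c, 0, a; b, -a, 0] (p + q + r)
    ((1 - (p * q + q * r + r * p - x ^ 2 - y ^ 2 - z ^ 2 + a ^ 2 + b ^ 2 + c ^ 2)) / 2)
    (by ext i j; fin_cases i <;> fin_cases j <;> simp)
    (by ext i j; fin_cases i <;> fin_cases j <;> simp)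
    (by
      ext i j
      fin_cases i <;> fin_cases j <;>
        simp [-mul_eq_mul_left_iff]
      all_goals linarith)
  have k : ∀ i j, (!![p, x, y; x, q, z; y, z, r] * !![0, c, -b; -c, 0, a; b, -a, 0]) i j = 0 :=
    fun i j => congrFun (congrFun hSA i) j
  simp only [Fin.forall_fin_succ] at k
  simp [Matrix.mul_apply, Fin.sum_univ_three] at k
  obtain ⟨⟨k00, k01, k02⟩, ⟨k10, k11, k12⟩, k20, k21, k22⟩ := k
  by_cases hzero : a = 0 ∧ b = 0 ∧ c = 0
  · obtain ⟨rfl, rfl, rfl⟩ := hzero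
    exfalso
    have hx : x = 0 := by grind
    have hy : y = 0 := by grind
    have hz : z = 0 := by grind
    subst hx hy hz
    have hqr : q * r = -1 := by linarith
    have hpr : p * r = -1 := by linarith
    have hpq : p * q = -1 := by linarith
    have hsq : (p * q * r) ^ 2 = -1 := by
      calc (p * q * r) ^ 2 = (q * r) * (p * r) * (p * q) := by ring
        _ = -1 := by rw [hqr, hpr, hpq]; norm_num
    linarith [sq_nonneg (p * q * r)]
  · have hminor : p * q - x ^ 2 = 0 ∧ p * r - y ^ 2 = 0 ∧ q * r - z ^ 2 = 0 := by
      by_cases ha : a = 0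
      · by_cases hb : b = 0
        · have hc : c ≠ 0 := fun hc => hzero ⟨ha, hb, hc⟩
          refine ⟨?_, ?_, ?_⟩ <;> apply mul_left_cancel₀ hc <;> grind
        · refine ⟨?_, ?_, ?_⟩ <;> apply mul_left_cancel₀ hb <;> grind
      · refine ⟨?_, ?_, ?_⟩ <;> apply mul_left_cancel₀ ha <;> grind
    obtain ⟨hpq, hpr, hqr⟩ := hminor
    have hn : a ^ 2 + b ^ 2 + c ^ 2 = 1 := by linarith
    refine ⟨p + q + r, ![a, b, c], by simpa using hn, ?_⟩
    ext i j
    fin_cases i <;> fin_cases j <;> simp [axialMatrix]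
    all_goals grind

theorem exists_so3_third_column (n : Fin 3 → ℝ) (hn : n 0 ^ 2 + n 1 ^ 2 + n 2 ^ 2 = 1) :
    ∃ R : Matrix (Fin 3) (Fin 3) ℝ, so3 R ∧ ∀ i, R i 2 = n i := by
  by_cases h : 1 + n 2 = 0
  · have h2 : n 2 = -1 := by linarith
    have h0 : n 0 = 0 := by nlinarith
    have h1 : n 1 = 0 := by nlinarith
    refine ⟨!![1, 0, 0; 0, -1, 0; 0, 0, -1], ⟨?_, ?_⟩, ?_⟩
    · ext i j
      fin_cases i <;> fin_cases j <;> simp [Matrix.mul_apply, Fin.sum_univ_three]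
    · simp [Matrix.det_fin_three]
    · intro i
      fin_cases i <;> simp [h0, h1, h2]
  · refine ⟨!![1 - n 0 ^ 2 / (1 + n 2), -(n 0 * n 1) / (1 + n 2), n 0;
      -(n 0 * n 1) / (1 + n 2), 1 - n 1 ^ 2 / (1 + n 2), n 1;
      -n 0, -n 1, n 2], ⟨?_, ?_⟩, ?_⟩
    · generalize n 0 = a at *
      generalize n 1 = b at *
      generalize n 2 = c at *
      ext i j
      fin_cases i <;> fin_cases j <;> simp [Matrix.mul_apply, Fin.sum_univ_three] <;> grind
    · generalize n 0 = a at *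
      generalize n 1 = b at *
      generalize n 2 = c at *
      simp [Matrix.det_fin_three]
      grind
    · intro i
      fin_cases i <;> simp

/-- Conjugating the normal form by `R ∈ SO(3)` gives the axial matrix of the last column of `R`. -/
theorem conj_normalForm_eq_axialMatrix (R : Matrix (Fin 3) (Fin 3) ℝ) (hR : so3 R) (ξ : ℝ) :
    R * !![0, 1, 0; -1, 0, 0; 0, 0, ξ] * R.transpose = axialMatrix ξ (fun i => R i 2) := by
  obtain ⟨hR, hdet⟩ := hR
  have hadj : R.adjugate = R.transpose := by
    have h : R.adjugate * (R * R.transpose) = R.transpose := by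
      rw [← mul_assoc, Matrix.adjugate_mul, hdet, one_smul, one_mul]
    rwa [hR, mul_one] at h
  have k : ∀ j, R.adjugate 2 j = R j 2 := fun j => by rw [hadj]; rfl
  have k0 := k 0
  have k1 := k 1
  have k2 := k 2
  simp [Matrix.adjugate_fin_three] at k0 k1 k2
  ext i j
  fin_cases i <;> fin_cases j <;>
    simp [axialMatrix, Matrix.mul_apply, Fin.sum_univ_three]
  all_goals linarith

/-- A linear map `J : ℝ³ → ℝ³` has zero torsion for the cross-product bracket iff it is
conjugate under some `R ∈ SO(3)` to the matrix with rows (0,1,0), (−1,0,0), (0,0,ξ). -/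
theorem stmt1 (J : Matrix (Fin 3) (Fin 3) ℝ) :
    torsion3 J ↔ ∃ (R : Matrix (Fin 3) (Fin 3) ℝ) (ξ : ℝ), so3 R ∧
      R⁻¹ * J * R = !![0, 1, 0; -1, 0, 0; 0, 0, ξ] := by
  constructor
  · intro hJ
    obtain ⟨t, n, hn, rfl⟩ := eq_axialMatrix_of_torsion3 J hJ
    obtain ⟨R, hR, hcol⟩ := exists_so3_third_column n hn
    refine ⟨R, t, hR, ?_⟩
    have hform := conj_normalForm_eq_axialMatrix R hR t
    rw [funext hcol] at hform
    have hRT : R.transpose * R = 1 := mul_eq_one_comm.mp hR.1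
    rw [← hform, Matrix.inv_eq_right_inv hR.1]
    simp only [mul_assoc]
    rw [hRT, mul_one, ← mul_assoc, hRT, one_mul]
  · rintro ⟨R, ξ, hR, h⟩
    have hform := conj_normalForm_eq_axialMatrix R hR ξ
    rw [← h, Matrix.inv_eq_right_inv hR.1] at hform
    simp only [mul_assoc] at hform
    rw [hR.1, mul_one, ← mul_assoc, hR.1, one_mul] at hform
    rw [hform]
    apply torsion3_axialMatrix
    have hRT : R.transpose * R = 1 := mul_eq_one_comm.mp hR.1
    have h22 := congrFun (congrFun hRT 2) 2
    simp [Matrix.mul_apply, Fin.sum_univ_three] at h22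
    linarith
end

section
/- Let g = g₁ × ⋯ × g_N be a finite product of real Lie algebras, with projections π⁽ʲ⁾ : g → g_j, and let J : g → g be a linear map with zero torsion. Set π^i_j = π⁽ⁱ⁾ ∘ J ∘ π⁽ʲ⁾ and let π̃^i_i be the restriction of π^i_i to g_i. Then: (i) for every i, the map π̃^i_i : g_i → g_i has zero torsion; (ii) for all i ≠ j and all X, Y ∈ g_j, [π^i_j X, π^i_j Y] = π^i_j [JX,Y] + π^i_j [X,JY]. -/
section PiSingle

variable {ι : Type*} [DecidableEq ι] {L : ι → Type*} [∀ j, LieRing (L j)]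

/-- Bracketing componentwise with an element of a factor on the right lands in that factor. -/
theorem pi_lie_single (Z : ∀ j, L j) (j : ι) (Y : L j) :
    (fun k => ⁅Z k, (Pi.single j Y : ∀ k, L k) k⁆) = Pi.single j ⁅Z j, Y⁆ := by
  funext k
  rcases eq_or_ne k j with rfl | h
  · simp
  · simp [Pi.single_eq_of_ne h]

/-- Bracketing componentwise with an element of a factor on the left lands in that factor. -/
theorem pi_single_lie (Z : ∀ j, L j) (j : ι) (X : L j) :
    (fun k => ⁅(Pi.single j X : ∀ k, L k) k, Z k⁆) = Pi.single j ⁅X, Z j⁆ := by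
  funext k
  rcases eq_or_ne k j with rfl | h
  · simp
  · simp [Pi.single_eq_of_ne h]

end PiSingle

/-- In a finite product `g = g₁ × ⋯ × g_N` of real Lie algebras (with componentwise
bracket), if a linear map `J : g → g` has zero torsion, then (i) each diagonal component
`π̃ⁱᵢ = πⁱ ∘ J ∘ πⁱ|_{gᵢ}` has zero torsion, and (ii) for `i ≠ j` and `X, Y ∈ g_j`,
`[πⁱⱼX, πⁱⱼY] = πⁱⱼ[JX,Y] + πⁱⱼ[X,JY]`.
Here `g_j` is included in `g` via `Pi.single j`, and `πⁱⱼ Z = (J (Pi.single j Z)) i`. -/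
theorem stmt2 {N : ℕ} (L : Fin N → Type*) [∀ j, LieRing (L j)] [∀ j, LieAlgebra ℝ (L j)]
    (J : (∀ j, L j) →ₗ[ℝ] (∀ j, L j))
    (hJ : ∀ X Y : ∀ j, L j,
      (fun j => ⁅J X j, J Y j⁆) - (fun j => ⁅X j, Y j⁆)
        - J (fun j => ⁅J X j, Y j⁆) - J (fun j => ⁅X j, J Y j⁆) = 0) :
    (∀ i, ∀ X Y : L i,
      ⁅J (Pi.single i X) i, J (Pi.single i Y) i⁆ - ⁅X, Y⁆
        - J (Pi.single i ⁅J (Pi.single i X) i, Y⁆) i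
        - J (Pi.single i ⁅X, J (Pi.single i Y) i⁆) i = 0) ∧
    (∀ i j, i ≠ j → ∀ X Y : L j,
      ⁅J (Pi.single j X) i, J (Pi.single j Y) i⁆
        = J (Pi.single j ⁅J (Pi.single j X) j, Y⁆) i
          + J (Pi.single j ⁅X, J (Pi.single j Y) j⁆) i) := by
  have key (i j : Fin N) (X Y : L j) :
      ⁅J (Pi.single j X) i, J (Pi.single j Y) i⁆ - (Pi.single j ⁅X, Y⁆ : ∀ k, L k) i
        - J (Pi.single j ⁅J (Pi.single j X) j, Y⁆) i
        - J (Pi.single j ⁅X, J (Pi.single j Y) j⁆) i = 0 := by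
    have h := hJ (Pi.single j X) (Pi.single j Y)
    rw [pi_lie_single, pi_lie_single, pi_single_lie, Pi.single_eq_same] at h
    exact congrFun h i
  refine ⟨fun i X Y => ?_, fun i j hij X Y => ?_⟩
  · simpa only [Pi.single_eq_same] using key i i X Y
  · have h := key i j X Y
    rwa [Pi.single_eq_of_ne hij, sub_zero, sub_sub, sub_eq_zero] at h
end

section
/- Every complex structure J on u(2) is equivalent under Aut(u(2)) to J(ξ) for a unique ξ ∈ ℝ, where J(ξ) is the 4×4 matrix with rows (0,1,0,0), (−1,0,0,0), (0,0,ξ,1), (0,0,−(1+ξ²),−ξ). Moreover, for ξ, ξ′ ∈ ℝ, J(ξ) and J(ξ′) are equivalent if and only if ξ = ξ′. -/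
/-- The Lie bracket of u(2) in the basis (J₁,J₂,J₃,J₄): cross product on the first three
coordinates, zero on the central coordinate. -/
def bra4 (x y : Fin 4 → ℝ) : Fin 4 → ℝ :=
  ![x 1 * y 2 - x 2 * y 1, x 2 * y 0 - x 0 * y 2, x 0 * y 1 - x 1 * y 0, 0]

/-- `J` (as a 4×4 matrix in the basis (J₁,J₂,J₃,J₄)) has zero torsion on u(2). -/
def torsion4 (J : Matrix (Fin 4) (Fin 4) ℝ) : Prop :=
  ∀ X Y : Fin 4 → ℝ,
    bra4 (J.mulVec X) (J.mulVec Y) - bra4 X Y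
      - J.mulVec (bra4 (J.mulVec X) Y) - J.mulVec (bra4 X (J.mulVec Y)) = 0

/-- `J` is a complex structure on u(2). -/
def isCx4 (J : Matrix (Fin 4) (Fin 4) ℝ) : Prop := J * J = -1 ∧ torsion4 J

/-- `Φ` (as a 4×4 matrix) is a Lie algebra automorphism of u(2). -/
def isAut4 (Φ : Matrix (Fin 4) (Fin 4) ℝ) : Prop :=
  IsUnit Φ.det ∧ ∀ x y, Φ.mulVec (bra4 x y) = bra4 (Φ.mulVec x) (Φ.mulVec y)

/-- The normal form J(ξ). -/
def Jxi (ξ : ℝ) : Matrix (Fin 4) (Fin 4) ℝ :=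
  !![0, 1, 0, 0; -1, 0, 0, 0; 0, 0, ξ, 1; 0, 0, -(1 + ξ ^ 2), -ξ]

open Matrix

/-- If an automorphism intertwines `K` with a complex structure, then `K` is a complex structure. -/
lemma isCx4_of_intertwine {J K Φ : Matrix (Fin 4) (Fin 4) ℝ} (hJ : isCx4 J) (hΦ : isAut4 Φ)
    (h : J * Φ = Φ * K) : isCx4 K := by
  obtain ⟨hu, hb⟩ := hΦ
  have hinv : Φ⁻¹ * Φ = 1 := Matrix.nonsing_inv_mul Φ hu
  have hv (X : Fin 4 → ℝ) : Φ *ᵥ (K *ᵥ X) = J *ᵥ (Φ *ᵥ X) := by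
    rw [Matrix.mulVec_mulVec, Matrix.mulVec_mulVec, h]
  refine ⟨?_, fun X Y => ?_⟩
  · have h1 : Φ * (K * K) = Φ * (-1) := by
      rw [← Matrix.mul_assoc, ← h, Matrix.mul_assoc, ← h, ← Matrix.mul_assoc, hJ.1]
      simp
    calc K * K = Φ⁻¹ * (Φ * (K * K)) := by rw [← Matrix.mul_assoc, hinv, Matrix.one_mul]
      _ = -1 := by rw [h1, ← Matrix.mul_assoc, hinv, Matrix.one_mul]
  · apply Matrix.mulVec_injective_of_isUnit ((Matrix.isUnit_iff_isUnit_det Φ).2 hu)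
    simp only [Matrix.mulVec_sub, hb, hv, Matrix.mulVec_zero]
    exact hJ.2 _ _

lemma isAut4_mul {Φ Ψ : Matrix (Fin 4) (Fin 4) ℝ} (hΦ : isAut4 Φ) (hΨ : isAut4 Ψ) :
    isAut4 (Φ * Ψ) := by
  refine ⟨?_, fun x y => ?_⟩
  · rw [Matrix.det_mul]
    exact hΦ.1.mul hΨ.1
  · simp only [← Matrix.mulVec_mulVec, hΨ.2, hΦ.2]

/-- A positively oriented orthonormal frame `(f, n × f, n)` of ℝ³ and a nonzero scaling of the
center define an automorphism of u(2). -/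
lemma isAut4_frame {f₀ f₁ f₂ n₀ n₁ n₂ c : ℝ} (hf : f₀ ^ 2 + f₁ ^ 2 + f₂ ^ 2 = 1)
    (hn : n₀ ^ 2 + n₁ ^ 2 + n₂ ^ 2 = 1) (hfn : f₀ * n₀ + f₁ * n₁ + f₂ * n₂ = 0) (hc : c ≠ 0) :
    isAut4 !![f₀, n₁ * f₂ - n₂ * f₁, n₀, 0; f₁, n₂ * f₀ - n₀ * f₂, n₁, 0;
      f₂, n₀ * f₁ - n₁ * f₀, n₂, 0; 0, 0, 0, c] := by
  refine ⟨?_, fun x y => ?_⟩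
  · have hdet : (!![f₀, n₁ * f₂ - n₂ * f₁, n₀, 0; f₁, n₂ * f₀ - n₀ * f₂, n₁, 0;
      f₂, n₀ * f₁ - n₁ * f₀, n₂, 0; 0, 0, 0, c] : Matrix (Fin 4) (Fin 4) ℝ).det = c := by
      simp [Matrix.det_succ_row_zero, Fin.sum_univ_succ, Fin.succAbove]
      linear_combination c * (n₀ ^ 2 + n₁ ^ 2 + n₂ ^ 2) * hf + c * hn
        - c * (f₀ * n₀ + f₁ * n₁ + f₂ * n₂) * hfn
    rw [hdet]
    exact hc.isUnit
  · ext i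
    fin_cases i <;> simp [bra4, Matrix.mulVec, dotProduct, Fin.sum_univ_four]
    · linear_combination (x 1 * y 2 - x 2 * y 1) * (n₀ * hfn - f₀ * hn)
        + (x 0 * y 1 - x 1 * y 0) * (f₀ * hfn - n₀ * hf)
    · linear_combination (x 1 * y 2 - x 2 * y 1) * (n₁ * hfn - f₁ * hn)
        + (x 0 * y 1 - x 1 * y 0) * (f₁ * hfn - n₁ * hf)
    · linear_combination (x 1 * y 2 - x 2 * y 1) * (n₂ * hfn - f₂ * hn)
        + (x 0 * y 1 - x 1 * y 0) * (f₂ * hfn - n₂ * hf)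

/-- Every vector of ℝ³ is orthogonal to some unit vector. -/
lemma exists_unit_orthogonal (a b c : ℝ) :
    ∃ f₀ f₁ f₂ : ℝ, f₀ ^ 2 + f₁ ^ 2 + f₂ ^ 2 = 1 ∧ f₀ * a + f₁ * b + f₂ * c = 0 := by
  by_cases h : a ^ 2 + b ^ 2 = 0
  · have ha : a = 0 := by nlinarith [sq_nonneg a, sq_nonneg b]
    exact ⟨1, 0, 0, by norm_num, by simp [ha]⟩
  · have hs : √(a ^ 2 + b ^ 2) ^ 2 = a ^ 2 + b ^ 2 := Real.sq_sqrt (by positivity)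
    have h0 : √(a ^ 2 + b ^ 2) ≠ 0 := fun h' => h (by rw [← hs, h']; norm_num)
    refine ⟨-b / √(a ^ 2 + b ^ 2), a / √(a ^ 2 + b ^ 2), 0, ?_, by ring⟩
    field_simp
    rw [hs]
    ring

/-- Some automorphism brings the image of the central vector into the plane of `J₃` and `J₄`,
with `J₃`-component one. -/
lemma exists_aut_central_column {J : Matrix (Fin 4) (Fin 4) ℝ} (hJ : J * J = -1) :
    ∃ Φ K : Matrix (Fin 4) (Fin 4) ℝ, isAut4 Φ ∧ J * Φ = Φ * K ∧
      K 0 3 = 0 ∧ K 1 3 = 0 ∧ K 2 3 = 1 := by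
  have h33 := congrFun (congrFun hJ 3) 3
  simp [Matrix.mul_apply, Fin.sum_univ_four] at h33
  set ρ := √(J 0 3 ^ 2 + J 1 3 ^ 2 + J 2 3 ^ 2)
  have hρ2 : ρ ^ 2 = J 0 3 ^ 2 + J 1 3 ^ 2 + J 2 3 ^ 2 := Real.sq_sqrt (by positivity)
  have hρ0 : ρ ≠ 0 := by
    intro h
    rw [h] at hρ2
    have h0 : J 0 3 = 0 := by nlinarith [sq_nonneg (J 0 3), sq_nonneg (J 1 3), sq_nonneg (J 2 3)]
    have h1 : J 1 3 = 0 := by nlinarith [sq_nonneg (J 0 3), sq_nonneg (J 1 3), sq_nonneg (J 2 3)]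
    have h2 : J 2 3 = 0 := by nlinarith [sq_nonneg (J 0 3), sq_nonneg (J 1 3), sq_nonneg (J 2 3)]
    rw [h0, h1, h2] at h33
    nlinarith [mul_self_nonneg (J 3 3)]
  obtain ⟨f₀, f₁, f₂, hf, hfn⟩ := exists_unit_orthogonal (J 0 3 / ρ) (J 1 3 / ρ) (J 2 3 / ρ)
  have hn : (J 0 3 / ρ) ^ 2 + (J 1 3 / ρ) ^ 2 + (J 2 3 / ρ) ^ 2 = 1 := by
    field_simp
    exact hρ2.symm
  have hΦ := isAut4_frame hf hn hfn (inv_ne_zero hρ0)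
  set Φ : Matrix (Fin 4) (Fin 4) ℝ := _ with hΦdef
  change isAut4 Φ at hΦ
  have hcol : (Φ⁻¹ * (J * Φ)) *ᵥ Pi.single 3 1 = ![0, 0, 1, J 3 3] := by
    have h1 : (J * Φ) *ᵥ Pi.single 3 1 = Φ *ᵥ ![0, 0, 1, J 3 3] := by
      ext i
      fin_cases i <;>
        simp [hΦdef, Matrix.mul_apply, Matrix.mulVec, dotProduct, Fin.sum_univ_four] <;> ring
    rw [← Matrix.mulVec_mulVec, h1, Matrix.mulVec_mulVec, Matrix.nonsing_inv_mul Φ hΦ.1,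
      Matrix.one_mulVec]
  rw [Matrix.mulVec_single_one] at hcol
  refine ⟨Φ, Φ⁻¹ * (J * Φ), hΦ, ?_, congrFun hcol 0, congrFun hcol 1, congrFun hcol 2⟩
  rw [← Matrix.mul_assoc, Matrix.mul_nonsing_inv Φ hΦ.1, Matrix.one_mul]

/-- A complex structure with normalized central column is `J(ξ)` up to the orientation of the
plane of `J₁` and `J₂`. -/
lemma eq_of_central_column {K : Matrix (Fin 4) (Fin 4) ℝ} (hK : isCx4 K)
    (h0 : K 0 3 = 0) (h1 : K 1 3 = 0) (h2 : K 2 3 = 1) :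
    ∃ ε ξ : ℝ, (ε = 1 ∨ ε = -1) ∧
      K = !![0, ε, 0, 0; -ε, 0, 0, 0; 0, 0, ξ, 1; 0, 0, -(1 + ξ ^ 2), -ξ] := by
  obtain ⟨hsq, ht⟩ := hK
  have t0 := ht (Pi.single 0 1) (Pi.single 3 1)
  have t1 := ht (Pi.single 1 1) (Pi.single 3 1)
  have e (i j : Fin 4) := congrFun (congrFun hsq i) j
  have t00 := congrFun t0 0
  have t01 := congrFun t0 1
  have t02 := congrFun t0 2
  have t03 := congrFun t0 3
  have t12 := congrFun t1 2
  have t13 := congrFun t1 3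
  simp [bra4, Matrix.mulVec, dotProduct, Fin.sum_univ_four, Matrix.vecHead, Matrix.vecTail,
    h0, h1, h2] at t00 t01 t02 t03 t12 t13
  have e00 := e 0 0
  have e03 := e 0 3
  have e13 := e 1 3
  have e23 := e 2 3
  have e33 := e 3 3
  have e01 := e 0 1
  simp [Matrix.mul_apply, Fin.sum_univ_four, h0, h1, h2] at e00 e01 e03 e13 e23 e33
  have k10 : K 1 0 = -K 0 1 := by linarith
  have k11 : K 1 1 = K 0 0 := by linarith
  have k20 : K 2 0 = 0 := by linarith
  have k30 : K 3 0 = 0 := by linarith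
  have k21 : K 2 1 = 0 := by linarith
  have k31 : K 3 1 = 0 := by linarith
  have k33 : K 3 3 = -K 2 2 := by linarith
  have k32 : K 3 2 = -(1 + K 2 2 ^ 2) := by
    rw [k33] at e33
    linarith
  rw [k10, k20] at e00
  rw [k11, k21] at e01
  have k00 : K 0 0 = 0 := by
    rcases mul_eq_zero.1 (show K 0 0 * K 0 1 = 0 by linarith) with h | h
    · exact h
    · rw [h] at e00
      nlinarith [mul_self_nonneg (K 0 0)]
  rw [k00] at e00 k11
  refine ⟨K 0 1, K 2 2, mul_self_eq_one_iff.1 ?_, ?_⟩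
  · linarith
  · ext i j
    fin_cases i <;> fin_cases j <;> simp [*]

/-- Every complex structure on u(2) is equivalent to some `J(ξ)`. -/
lemma exists_aut_Jxi {J : Matrix (Fin 4) (Fin 4) ℝ} (hJ : isCx4 J) :
    ∃ ξ : ℝ, ∃ Φ : Matrix (Fin 4) (Fin 4) ℝ, isAut4 Φ ∧ J = Φ * Jxi ξ * Φ⁻¹ := by
  suffices h : ∃ ξ : ℝ, ∃ Φ : Matrix (Fin 4) (Fin 4) ℝ, isAut4 Φ ∧ J * Φ = Φ * Jxi ξ by
    obtain ⟨ξ, Φ, hΦ, h⟩ := h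
    refine ⟨ξ, Φ, hΦ, ?_⟩
    rw [← h, Matrix.mul_assoc, Matrix.mul_nonsing_inv Φ hΦ.1, Matrix.mul_one]
  obtain ⟨Φ, K, hΦ, hJK, h0, h1, h2⟩ := exists_aut_central_column hJ.1
  obtain ⟨ε, ξ, rfl | rfl, rfl⟩ :=
    eq_of_central_column (isCx4_of_intertwine hJ hΦ hJK) h0 h1 h2
  · exact ⟨ξ, Φ, hΦ, hJK⟩
  · have hΨ := isAut4_frame (f₀ := 0) (f₁ := 1) (f₂ := 0) (n₀ := 0) (n₁ := 0) (n₂ := -1) (c := -1)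
      (by norm_num) (by norm_num) (by norm_num) (by norm_num)
    refine ⟨ξ, _, isAut4_mul hΦ hΨ, ?_⟩
    rw [← Matrix.mul_assoc, hJK, Matrix.mul_assoc, Matrix.mul_assoc]
    congr 1
    ext i j
    fin_cases i <;> fin_cases j <;> simp [Jxi, Matrix.mul_apply, Fin.sum_univ_four]

/-- The central diagonal entry is invariant under automorphisms. -/
lemma neg_central_entry_eq {J Φ : Matrix (Fin 4) (Fin 4) ℝ} {ξ : ℝ} (hΦ : isAut4 Φ)
    (h : J = Φ * Jxi ξ * Φ⁻¹) : ξ = -J 3 3 := by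
  obtain ⟨hu, hb⟩ := hΦ
  have hJ : J * Φ = Φ * Jxi ξ := by
    rw [h, Matrix.mul_assoc, Matrix.nonsing_inv_mul Φ hu, Matrix.mul_one]
  have r0 := congrFun (hb (Pi.single 1 1) (Pi.single 2 1)) 3
  have r1 := congrFun (hb (Pi.single 2 1) (Pi.single 0 1)) 3
  have r2 := congrFun (hb (Pi.single 0 1) (Pi.single 1 1)) 3
  simp [bra4, Matrix.mulVec, dotProduct, Fin.sum_univ_four] at r0 r1 r2
  have h3 : Φ 3 3 ≠ 0 := by
    intro h3
    refine hu.ne_zero (Matrix.det_eq_zero_of_row_eq_zero 3 fun j => ?_)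
    fin_cases j <;> assumption
  have hcenter (y : Fin 4 → ℝ) : bra4 (Φ *ᵥ Pi.single 3 1) y = 0 := by
    have hy := hb (Pi.single 3 1) (Φ⁻¹ *ᵥ y)
    rw [Matrix.mulVec_mulVec, Matrix.mul_nonsing_inv Φ hu, Matrix.one_mulVec] at hy
    rw [← hy, show bra4 (Pi.single 3 1) (Φ⁻¹ *ᵥ y) = 0 by ext i; fin_cases i <;> simp [bra4],
      Matrix.mulVec_zero]
  have c0 := congrFun (hcenter (Pi.single 1 1)) 2
  have c1 := congrFun (hcenter (Pi.single 0 1)) 2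
  have c2 := congrFun (hcenter (Pi.single 0 1)) 1
  simp [bra4] at c0 c1 c2
  have e := congrFun (congrFun hJ.symm 3) 3
  simp [Jxi, Matrix.mul_apply, Fin.sum_univ_four, r0, r1, r2, c0, c1, c2] at e
  exact mul_left_cancel₀ h3 (by linarith)

/-- Every complex structure on u(2) is equivalent under Aut(u(2)) to J(ξ) for a unique
ξ ∈ ℝ; and J(ξ), J(ξ′) are equivalent iff ξ = ξ′. -/
theorem stmt4 :
    (∀ J : Matrix (Fin 4) (Fin 4) ℝ, isCx4 J →
      ∃! ξ : ℝ, ∃ Φ : Matrix (Fin 4) (Fin 4) ℝ, isAut4 Φ ∧ J = Φ * Jxi ξ * Φ⁻¹) ∧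
    (∀ ξ ξ' : ℝ,
      (∃ Φ : Matrix (Fin 4) (Fin 4) ℝ, isAut4 Φ ∧ Jxi ξ' = Φ * Jxi ξ * Φ⁻¹) ↔ ξ = ξ') := by
  refine ⟨fun J hJ => ?_, fun ξ ξ' => ⟨?_, ?_⟩⟩
  · obtain ⟨ξ, Φ, hΦ, h⟩ := exists_aut_Jxi hJ
    refine ⟨ξ, ⟨Φ, hΦ, h⟩, ?_⟩
    rintro ξ' ⟨Φ', hΦ', h'⟩
    rw [neg_central_entry_eq hΦ h, neg_central_entry_eq hΦ' h']
  · rintro ⟨Φ, hΦ, h⟩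
    simpa [Jxi] using neg_central_entry_eq hΦ h
  · rintro rfl
    exact ⟨1, ⟨by simp, by simp⟩, by simp⟩
end

section
/- A 4×4 real matrix is a complex structure on u(2) if and only if there exist ξ ∈ ℝ, (a¹,a²,a³) ∈ ℝ³ ∖ {0}, and c = ±((a¹)²+(a²)²+(a³)²)^{−1/2} (either sign) such that the matrix has rows: ((a¹)²c²ξ, (a³+a²a¹cξ)c, (a³a¹cξ−a²)c, a¹); (−(a³−a²a¹cξ)c, (a²)²c²ξ, (a³a²cξ+a¹)c, a²); ((a³a¹cξ+a²)c, (a³a²cξ−a¹)c, (a³)²c²ξ, a³); (−(ξ²+1)c²a¹, −(ξ²+1)c²a², −(ξ²+1)c²a³, −ξ). -/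
theorem mulVec_fin_four {R : Type*} [NonUnitalNonAssocSemiring R] (M : Matrix (Fin 4) (Fin 4) R)
    (v : Fin 4 → R) (i : Fin 4) :
    M.mulVec v i = M i 0 * v 0 + M i 1 * v 1 + M i 2 * v 2 + M i 3 * v 3 := by
  simp [Matrix.mulVec, dotProduct, Fin.sum_univ_four]

/-- The matrix sending `(v, 0)` to `(c²ξ⟨a, v⟩a - c a × v, -(ξ² + 1)c²⟨a, v⟩)` and the central
vector `J₄` to `(a, -ξ)`. -/
def cxMatrix (ξ a1 a2 a3 c : ℝ) : Matrix (Fin 4) (Fin 4) ℝ :=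
  !![a1 ^ 2 * c ^ 2 * ξ, (a3 + a2 * a1 * c * ξ) * c, (a3 * a1 * c * ξ - a2) * c, a1;
     -((a3 - a2 * a1 * c * ξ) * c), a2 ^ 2 * c ^ 2 * ξ, (a3 * a2 * c * ξ + a1) * c, a2;
     (a3 * a1 * c * ξ + a2) * c, (a3 * a2 * c * ξ - a1) * c, a3 ^ 2 * c ^ 2 * ξ, a3;
     -((ξ ^ 2 + 1) * c ^ 2 * a1), -((ξ ^ 2 + 1) * c ^ 2 * a2), -((ξ ^ 2 + 1) * c ^ 2 * a3), -ξ]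

theorem isCx4_cxMatrix {ξ a1 a2 a3 c : ℝ} (hc : c ^ 2 * (a1 ^ 2 + a2 ^ 2 + a3 ^ 2) = 1) :
    isCx4 (cxMatrix ξ a1 a2 a3 c) := by
  constructor
  · ext i j
    fin_cases i <;> fin_cases j <;>
      simp [cxMatrix, Matrix.mul_apply, Fin.sum_univ_four] <;> grind
  · intro X Y
    ext i
    fin_cases i <;>
      simp only [cxMatrix, bra4, mulVec_fin_four, Pi.sub_apply, Pi.zero_apply] <;> simp <;> grind

theorem eq_zero_of_sum_three_sq_eq_zero {a b c : ℝ} (h : a ^ 2 + b ^ 2 + c ^ 2 = 0) :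
    a = 0 ∧ b = 0 ∧ c = 0 := by
  refine ⟨?_, ?_, ?_⟩ <;> nlinarith [sq_nonneg a, sq_nonneg b, sq_nonneg c]

/-- A `3 × 3` matrix that has the eigenvector `a ≠ 0` and commutes with the cross product by `a`
is a combination of `a aᵀ`, the identity and the cross product by `a`. -/
theorem entries_of_commute_cross {A00 A01 A02 A10 A11 A12 A20 A21 A22 a1 a2 a3 ξ n : ℝ}
    (hn : n = a1 ^ 2 + a2 ^ 2 + a3 ^ 2) (hn0 : n ≠ 0)
    (e0 : A00 * a1 + A01 * a2 + A02 * a3 = ξ * a1)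
    (e1 : A10 * a1 + A11 * a2 + A12 * a3 = ξ * a2)
    (e2 : A20 * a1 + A21 * a2 + A22 * a3 = ξ * a3)
    (t00 : A10 * a3 - A20 * a2 - (-(A01 * a3) + A02 * a2) = 0)
    (t01 : A20 * a1 - A00 * a3 - (-(A11 * a3) + A12 * a2) = 0)
    (t02 : A00 * a2 - A10 * a1 - (-(A21 * a3) + A22 * a2) = 0)
    (t10 : A11 * a3 - A21 * a2 - (A00 * a3 + -(A02 * a1)) = 0)
    (t11 : A21 * a1 - A01 * a3 - (A10 * a3 + -(A12 * a1)) = 0)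
    (t12 : A01 * a2 - A11 * a1 - (A20 * a3 + -(A22 * a1)) = 0)
    (t20 : A12 * a3 - A22 * a2 - (-(A00 * a2) + A01 * a1) = 0)
    (t21 : A22 * a1 - A02 * a3 - (-(A10 * a2) + A11 * a1) = 0) :
    ∃ p q c : ℝ, n * p = ξ - q ∧
      A00 = p * a1 * a1 + q ∧ A01 = p * a1 * a2 + c * a3 ∧ A02 = p * a1 * a3 - c * a2 ∧
      A10 = p * a1 * a2 - c * a3 ∧ A11 = p * a2 * a2 + q ∧ A12 = p * a2 * a3 + c * a1 ∧
      A20 = p * a1 * a3 + c * a2 ∧ A21 = p * a2 * a3 - c * a1 ∧ A22 = p * a3 * a3 + q := by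
  obtain ⟨q, hq⟩ : ∃ q, 2 * q = A00 + A11 + A22 - ξ := ⟨(A00 + A11 + A22 - ξ) / 2, by ring⟩
  obtain ⟨c, hc⟩ : ∃ c, 2 * n * c = a3 * (A01 - A10) + a1 * (A12 - A21) + a2 * (A20 - A02) :=
    ⟨(a3 * (A01 - A10) + a1 * (A12 - A21) + a2 * (A20 - A02)) / (2 * n), by field_simp⟩
  obtain ⟨p, hp⟩ : ∃ p, n * p = ξ - q := ⟨(ξ - q) / n, by field_simp⟩
  refine ⟨p, q, c, hp, ?_, ?_, ?_, ?_, ?_, ?_, ?_, ?_, ?_⟩ <;> apply mul_left_cancel₀ hn0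
  · have : n * A00 = (ξ - q) * a1 * a1 + n * q := by clear hp; grind
    linear_combination this - a1 * a1 * hp
  · have : n * A01 = (ξ - q) * a1 * a2 + n * c * a3 := by clear hp; grind
    linear_combination this - a1 * a2 * hp
  · have : n * A02 = (ξ - q) * a1 * a3 - n * c * a2 := by clear hp; grind
    linear_combination this - a1 * a3 * hp
  · have : n * A10 = (ξ - q) * a1 * a2 - n * c * a3 := by clear hp; grind
    linear_combination this - a1 * a2 * hp
  · have : n * A11 = (ξ - q) * a2 * a2 + n * q := by clear hp; grind
    linear_combination this - a2 * a2 * hp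
  · have : n * A12 = (ξ - q) * a2 * a3 + n * c * a1 := by clear hp; grind
    linear_combination this - a2 * a3 * hp
  · have : n * A20 = (ξ - q) * a1 * a3 + n * c * a2 := by clear hp; grind
    linear_combination this - a1 * a3 * hp
  · have : n * A21 = (ξ - q) * a2 * a3 - n * c * a1 := by clear hp; grind
    linear_combination this - a2 * a3 * hp
  · have : n * A22 = (ξ - q) * a3 * a3 + n * q := by clear hp; grind
    linear_combination this - a3 * a3 * hp

set_option maxHeartbeats 1000000 in
/-- The `su(2)` block of a complex structure commutes with the cross product by `a`, so it acts as
`ξ` on `a` and as a scalar `q` plus `-c a ×` on the orthogonal complement of `a`. Squaring to `-1`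
there forces `q = 0`. -/
theorem isCx4.exists_eq_cxMatrix {J : Matrix (Fin 4) (Fin 4) ℝ} (h : isCx4 J) :
    ∃ ξ a1 a2 a3 c : ℝ, c ^ 2 * (a1 ^ 2 + a2 ^ 2 + a3 ^ 2) = 1 ∧ J = cxMatrix ξ a1 a2 a3 c := by
  obtain ⟨hsq, htor⟩ := h
  have e := fun i j => congrFun (congrFun hsq i) j
  have t := fun i k => congrFun (htor (Pi.single i 1) ![0, 0, 0, 1]) k
  simp only [bra4, mulVec_fin_four, Pi.sub_apply, Pi.zero_apply] at t
  simp [Fin.forall_fin_succ, Fin.sum_univ_four, Matrix.mul_apply, Matrix.one_apply] at e t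
  obtain ⟨⟨e00, e01, e02, e03⟩, ⟨e10, e11, e12, e13⟩, ⟨e20, e21, e22, e23⟩, -, -, -, e33⟩ := e
  obtain ⟨⟨t00, t01, t02, t03⟩, ⟨t10, t11, t12, t13⟩, ⟨t20, t21, -, t23⟩, -⟩ := t
  obtain ⟨ξ, hξ⟩ : ∃ ξ, J 3 3 = -ξ := ⟨-J 3 3, by simp⟩
  obtain ⟨n, hn⟩ : ∃ n, n = J 0 3 ^ 2 + J 1 3 ^ 2 + J 2 3 ^ 2 := ⟨_, rfl⟩
  have hn0 : n ≠ 0 := by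
    rintro rfl
    obtain ⟨h0, h1, h2⟩ := eq_zero_of_sum_three_sq_eq_zero hn.symm
    rw [h0, h1, h2] at e33
    nlinarith [sq_nonneg (J 3 3)]
  obtain ⟨s, hs⟩ : ∃ s, n * s = -(ξ ^ 2 + 1) := ⟨-(ξ ^ 2 + 1) / n, by field_simp⟩
  rw [hξ] at e03 e13 e23 e33
  have b0 : J 3 0 = s * J 0 3 := mul_left_cancel₀ hn0 (by
    linear_combination J 3 0 * hn + J 0 3 * e33 - J 2 3 * t13 + J 1 3 * t23 - J 0 3 * hs)
  have b1 : J 3 1 = s * J 1 3 := mul_left_cancel₀ hn0 (by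
    linear_combination J 3 1 * hn + J 1 3 * e33 + J 2 3 * t03 - J 0 3 * t23 - J 1 3 * hs)
  have b2 : J 3 2 = s * J 2 3 := mul_left_cancel₀ hn0 (by
    linear_combination J 3 2 * hn + J 2 3 * e33 - J 1 3 * t03 + J 0 3 * t13 - J 2 3 * hs)
  obtain ⟨p, q, c, hp, A00, A01, A02, A10, A11, A12, A20, A21, A22⟩ :=
    entries_of_commute_cross (ξ := ξ) hn hn0 (by linarith) (by linarith) (by linarith)
      t00 t01 t02 t10 t11 t12 t20 t21
  rw [A00, A01, A02, A10, A20, b0] at e00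
  rw [A00, A01, A02, A11, A21, b1] at e01
  rw [A00, A01, A02, A12, A22, b2] at e02
  rw [A00, A10, A11, A12, A20, b0] at e10
  rw [A01, A10, A11, A12, A21, b1] at e11
  rw [A02, A10, A11, A12, A22, b2] at e12
  rw [A00, A10, A20, A21, A22, b0] at e20
  rw [A01, A11, A20, A21, A22, b1] at e21
  rw [A02, A12, A20, A21, A22, b2] at e22
  have hqc : q * c = 0 := mul_left_cancel₀ hn0 (by
    linear_combination q * c * hn + J 2 3 * (e01 - e10) / 4 + J 0 3 * (e12 - e21) / 4
      + J 1 3 * (e20 - e02) / 4)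
  have hqn : q ^ 2 + 1 = n * c ^ 2 := by
    have htr : n ^ 2 * p ^ 2 + 2 * n * p * q + 3 * q ^ 2 - 2 * c ^ 2 * n + n * s = -3 := by
      rw [hn]
      linear_combination e00 + e11 + e22
    linear_combination htr / 2 - (n * p + ξ - q) / 2 * hp - q * hp - hs / 2
  have hc0 : c ≠ 0 := by
    rintro rfl
    nlinarith [sq_nonneg q]
  obtain rfl : q = 0 := by simpa [hc0] using hqc
  have hcn : c ^ 2 * n = 1 := by linarith
  have hp' : p = c ^ 2 * ξ := by linear_combination c ^ 2 * hp - p * hcn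
  have hs' : s = -((ξ ^ 2 + 1) * c ^ 2) := by linear_combination c ^ 2 * hs - s * hcn
  refine ⟨ξ, J 0 3, J 1 3, J 2 3, c, hn ▸ hcn, ?_⟩
  ext i j
  fin_cases i <;> fin_cases j <;>
    simp [cxMatrix, hξ, b0, b1, b2, A00, A01, A02, A10, A11, A12, A20, A21, A22, hp', hs'] <;> ring

/-- A 4×4 real matrix is a complex structure on u(2) iff it has the explicit form
(Xu2) with parameters ξ ∈ ℝ, (a¹,a²,a³) ≠ 0 and c = ±((a¹)²+(a²)²+(a³)²)^(−1/2). -/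
theorem stmt5 (J : Matrix (Fin 4) (Fin 4) ℝ) :
    isCx4 J ↔
      ∃ ξ a1 a2 a3 c : ℝ,
        (a1, a2, a3) ≠ (0, 0, 0) ∧
        (c = (Real.sqrt (a1 ^ 2 + a2 ^ 2 + a3 ^ 2))⁻¹ ∨
          c = -(Real.sqrt (a1 ^ 2 + a2 ^ 2 + a3 ^ 2))⁻¹) ∧
        J = !![a1 ^ 2 * c ^ 2 * ξ, (a3 + a2 * a1 * c * ξ) * c, (a3 * a1 * c * ξ - a2) * c, a1;
               -((a3 - a2 * a1 * c * ξ) * c), a2 ^ 2 * c ^ 2 * ξ, (a3 * a2 * c * ξ + a1) * c, a2;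
               (a3 * a1 * c * ξ + a2) * c, (a3 * a2 * c * ξ - a1) * c, a3 ^ 2 * c ^ 2 * ξ, a3;
               -((ξ ^ 2 + 1) * c ^ 2 * a1), -((ξ ^ 2 + 1) * c ^ 2 * a2),
                 -((ξ ^ 2 + 1) * c ^ 2 * a3), -ξ] := by
  have sq_inv {a1 a2 a3 c : ℝ} (h : c ^ 2 * (a1 ^ 2 + a2 ^ 2 + a3 ^ 2) = 1) :
      c ^ 2 = (√(a1 ^ 2 + a2 ^ 2 + a3 ^ 2))⁻¹ ^ 2 := by
    rw [inv_pow, Real.sq_sqrt (by positivity)]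
    exact eq_inv_of_mul_eq_one_left h
  constructor
  · intro h
    obtain ⟨ξ, a1, a2, a3, c, hc, rfl⟩ := h.exists_eq_cxMatrix
    refine ⟨ξ, a1, a2, a3, c, ?_, sq_eq_sq_iff_eq_or_eq_neg.mp (sq_inv hc), rfl⟩
    intro ha
    simp_all
  · rintro ⟨ξ, a1, a2, a3, c, ha, hc, rfl⟩
    have hn : a1 ^ 2 + a2 ^ 2 + a3 ^ 2 ≠ 0 := by
      contrapose! ha
      obtain ⟨h1, h2, h3⟩ := eq_zero_of_sum_three_sq_eq_zero ha
      rw [h1, h2, h3]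
    refine isCx4_cxMatrix ?_
    rw [sq_eq_sq_iff_eq_or_eq_neg.mpr hc, inv_pow, Real.sq_sqrt (by positivity),
      inv_mul_cancel₀ hn]
end

section
/- u(2) admits no abelian complex structure: for every complex structure J on u(2) there exist X, Y ∈ u(2) with [JX, JY] ≠ [X, Y] (equivalently, the subalgebra m = {X − iJX : X ∈ u(2)} of the complexification of u(2) is not abelian). -/
/-- A vector whose bracket with everything vanishes lies in the span of `J₄`. -/
lemma eq_smul_single_of_bra4_eq_zero {x : Fin 4 → ℝ} (h : ∀ y, bra4 x y = 0) :
    x = x 3 • Pi.single 3 1 := by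
  have h₀ := h (Pi.single 0 1)
  have h₁ := h (Pi.single 1 1)
  funext i
  fin_cases i
  · simpa [bra4] using congrFun h₁ 2
  · simpa [bra4] using congrFun h₀ 2
  · simpa [bra4] using congrFun h₀ 1
  · simp

/-- u(2) admits no abelian complex structure: for every complex structure J on u(2)
there are X, Y with [JX, JY] ≠ [X, Y]. -/
theorem stmt7 (J : Matrix (Fin 4) (Fin 4) ℝ) (hJ : isCx4 J) :
    ∃ X Y : Fin 4 → ℝ, bra4 (J.mulVec X) (J.mulVec Y) ≠ bra4 X Y := by
  by_contra! h
  have hsq (v : Fin 4 → ℝ) : J.mulVec (J.mulVec v) = -v := by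
    rw [Matrix.mulVec_mulVec, hJ.1, Matrix.neg_mulVec, Matrix.one_mulVec]
  -- The image of the center is central, since `J` is surjective.
  have hcentral (y : Fin 4 → ℝ) : bra4 (J.mulVec (Pi.single 3 1)) y = 0 := by
    have hy := h (Pi.single 3 1) (-J.mulVec y)
    rw [Matrix.mulVec_neg, hsq, neg_neg] at hy
    rw [hy]
    funext i
    fin_cases i <;> simp [bra4]
  have heigen := eq_smul_single_of_bra4_eq_zero hcentral
  set c := J.mulVec (Pi.single 3 1) 3
  have hc := hsq (Pi.single 3 1)
  rw [heigen, Matrix.mulVec_smul, heigen] at hc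
  have hc₃ : c * c = -1 := by simpa using congrFun hc 3
  nlinarith [mul_self_nonneg c]
end

section
/- A linear endomorphism Φ of su(2) ⊕ su(2) is a Lie algebra automorphism if and only if either Φ = diag(Φ₁,Φ₂) with Φ₁, Φ₂ ∈ SO(3), or Φ = τ ∘ diag(Φ₁,Φ₂) with Φ₁, Φ₂ ∈ SO(3), where τ is the swap of the two factors. That is, Aut(su(2) ⊕ su(2)) = (SO(3) × SO(3)) ∪ τ(SO(3) × SO(3)). -/
/-- The componentwise Lie bracket of su(2) ⊕ su(2) ≅ ℝ³ × ℝ³. -/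
def bra33 (x y : (Fin 3 → ℝ) × (Fin 3 → ℝ)) : (Fin 3 → ℝ) × (Fin 3 → ℝ) :=
  (cross x.1 y.1, cross x.2 y.2)

open Matrix

/-- A linear map of ℝ³ preserving the cross product is zero or special orthogonal. -/
theorem eq_zero_or_so3_of_map_cross (M : Matrix (Fin 3) (Fin 3) ℝ)
    (h : ∀ x y, M *ᵥ cross x y = cross (M *ᵥ x) (M *ᵥ y)) : M = 0 ∨ so3 M := by
  have h01 := h ![1, 0, 0] ![0, 1, 0]
  have h12 := h ![0, 1, 0] ![0, 0, 1]
  have h20 := h ![0, 0, 1] ![1, 0, 0]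
  simp [cross, funext_iff, Fin.forall_fin_succ, mulVec, dotProduct, Fin.sum_univ_three]
    at h01 h12 h20
  obtain ⟨c0, c1, c2⟩ := h01
  obtain ⟨a0, a1, a2⟩ := h12
  obtain ⟨b0, b1, b2⟩ := h20
  have gram : Mᵀ * M = M.det • (1 : Matrix (Fin 3) (Fin 3) ℝ) := by
    ext i j
    fin_cases i <;> fin_cases j <;>
      simp [mul_apply, Fin.sum_univ_three, det_fin_three] <;> grind
  have hdet : M.det = 0 ∨ M.det = 1 := by
    have hd := congrArg det gram
    simp only [det_mul, det_transpose, det_smul, det_one, Fintype.card_fin, mul_one] at hd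
    have : M.det ^ 2 * (M.det - 1) = 0 := by linear_combination -hd
    rcases mul_eq_zero.mp this with h0 | h1
    · exact Or.inl (pow_eq_zero_iff two_ne_zero |>.mp h0)
    · exact Or.inr (sub_eq_zero.mp h1)
  rcases hdet with h0 | h1
  · left
    rw [h0, zero_smul, ← conjTranspose_eq_transpose_of_trivial] at gram
    exact conjTranspose_mul_self_eq_zero.mp gram
  · right
    rw [h1, one_smul] at gram
    exact ⟨mul_eq_one_comm.mp gram, h1⟩

theorem so3.map_cross {R : Matrix (Fin 3) (Fin 3) ℝ} (hR : so3 R) (x y : Fin 3 → ℝ) :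
    R *ᵥ cross x y = cross (R *ᵥ x) (R *ᵥ y) := by
  have hadj : R.adjugate = Rᵀ := by
    calc R.adjugate = R.adjugate * (R * Rᵀ) := by rw [hR.1, mul_one]
      _ = Rᵀ := by rw [← mul_assoc, adjugate_mul, hR.2, one_smul, one_mul]
  have e : ∀ i j, R.adjugate i j = R j i := fun i j => by rw [hadj, transpose_apply]
  rw [adjugate_fin_three] at e
  simp [Fin.forall_fin_succ] at e
  obtain ⟨⟨e00, e01, e02⟩, ⟨e10, e11, e12⟩, e20, e21, e22⟩ := e
  ext i
  fin_cases i <;> simp [cross, mulVec, dotProduct, Fin.sum_univ_three]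
  · linear_combination -e00 * (x 1 * y 2 - x 2 * y 1) - e10 * (x 2 * y 0 - x 0 * y 2)
      - e20 * (x 0 * y 1 - x 1 * y 0)
  · linear_combination -e01 * (x 1 * y 2 - x 2 * y 1) - e11 * (x 2 * y 0 - x 0 * y 2)
      - e21 * (x 0 * y 1 - x 1 * y 0)
  · linear_combination -e02 * (x 1 * y 2 - x 2 * y 1) - e12 * (x 2 * y 0 - x 0 * y 2)
      - e22 * (x 0 * y 1 - x 1 * y 0)

theorem so3.bijective {R : Matrix (Fin 3) (Fin 3) ℝ} (hR : so3 R) :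
    Function.Bijective R.mulVec := by
  refine Function.bijective_iff_has_inverse.mpr ⟨Rᵀ.mulVec, fun x => ?_, fun x => ?_⟩
  · rw [mulVec_mulVec, mul_eq_one_comm.mp hR.1, one_mulVec]
  · rw [mulVec_mulVec, hR.1, one_mulVec]

theorem eq_zero_of_forall_cross_eq_zero {v : Fin 3 → ℝ} (h : ∀ u, cross u v = 0) : v = 0 := by
  have h0 := h ![1, 0, 0]
  have h1 := h ![0, 1, 0]
  simp [cross] at h0 h1
  ext i
  fin_cases i <;> simp [h0, h1]

/-- The images of two maps commute, and one of them is everything, so the other is zero. -/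
theorem so3.eq_zero_of_cross {R M : Matrix (Fin 3) (Fin 3) ℝ} (hR : so3 R)
    (h : ∀ x y, cross (R *ᵥ x) (M *ᵥ y) = 0) : M = 0 := by
  refine ext_of_mulVec_single fun i => ?_
  rw [zero_mulVec]
  refine eq_zero_of_forall_cross_eq_zero fun u => ?_
  obtain ⟨x, rfl⟩ := hR.bijective.2 u
  exact h x _

theorem cross_zero (x : Fin 3 → ℝ) : cross x 0 = 0 := by
  simp [cross]

theorem zero_cross (x : Fin 3 → ℝ) : cross 0 x = 0 := by
  simp [cross]

theorem cross_eq_zero_comm {x y : Fin 3 → ℝ} (h : cross x y = 0) : cross y x = 0 := by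
  simp [cross] at h ⊢
  grind

/-- A linear endomorphism of su(2) ⊕ su(2) is a Lie algebra automorphism iff it is
diag(Φ₁,Φ₂) with Φ₁,Φ₂ ∈ SO(3), or τ ∘ diag(Φ₁,Φ₂) with Φ₁,Φ₂ ∈ SO(3), τ the swap. -/
theorem stmt8 (Φ : ((Fin 3 → ℝ) × (Fin 3 → ℝ)) →ₗ[ℝ] ((Fin 3 → ℝ) × (Fin 3 → ℝ))) :
    (Function.Bijective Φ ∧ ∀ x y, Φ (bra33 x y) = bra33 (Φ x) (Φ y)) ↔
    ((∃ Φ₁ Φ₂ : Matrix (Fin 3) (Fin 3) ℝ, so3 Φ₁ ∧ so3 Φ₂ ∧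
        ∀ x y : Fin 3 → ℝ, Φ (x, y) = (Φ₁.mulVec x, Φ₂.mulVec y)) ∨
      (∃ Φ₁ Φ₂ : Matrix (Fin 3) (Fin 3) ℝ, so3 Φ₁ ∧ so3 Φ₂ ∧
        ∀ x y : Fin 3 → ℝ, Φ (x, y) = (Φ₂.mulVec y, Φ₁.mulVec x))) := by
  constructor
  · rintro ⟨⟨hinj, -⟩, hΦ⟩
    obtain ⟨A, hA⟩ : ∃ A : Matrix (Fin 3) (Fin 3) ℝ, ∀ x, (Φ (x, 0)).1 = A *ᵥ x :=
      ⟨LinearMap.toMatrix' (LinearMap.fst ℝ _ _ ∘ₗ Φ ∘ₗ LinearMap.inl ℝ _ _), fun x => by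
        simp [LinearMap.toMatrix'_mulVec]⟩
    obtain ⟨B, hB⟩ : ∃ B : Matrix (Fin 3) (Fin 3) ℝ, ∀ y, (Φ (0, y)).1 = B *ᵥ y :=
      ⟨LinearMap.toMatrix' (LinearMap.fst ℝ _ _ ∘ₗ Φ ∘ₗ LinearMap.inr ℝ _ _), fun x => by
        simp [LinearMap.toMatrix'_mulVec]⟩
    obtain ⟨C, hC⟩ : ∃ C : Matrix (Fin 3) (Fin 3) ℝ, ∀ x, (Φ (x, 0)).2 = C *ᵥ x :=
      ⟨LinearMap.toMatrix' (LinearMap.snd ℝ _ _ ∘ₗ Φ ∘ₗ LinearMap.inl ℝ _ _), fun x => by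
        simp [LinearMap.toMatrix'_mulVec]⟩
    obtain ⟨D, hD⟩ : ∃ D : Matrix (Fin 3) (Fin 3) ℝ, ∀ y, (Φ (0, y)).2 = D *ᵥ y :=
      ⟨LinearMap.toMatrix' (LinearMap.snd ℝ _ _ ∘ₗ Φ ∘ₗ LinearMap.inr ℝ _ _), fun x => by
        simp [LinearMap.toMatrix'_mulVec]⟩
    have hl : ∀ x, Φ (x, 0) = (A *ᵥ x, C *ᵥ x) := fun x => Prod.ext (hA x) (hC x)
    have hr : ∀ y, Φ (0, y) = (B *ᵥ y, D *ᵥ y) := fun y => Prod.ext (hB y) (hD y)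
    have hsplit : ∀ x y, Φ (x, y) = (A *ᵥ x + B *ᵥ y, C *ᵥ x + D *ᵥ y) := fun x y => by
      rw [← Prod.mk_add_mk, ← hl, ← hr, ← map_add, Prod.mk_add_mk, add_zero, zero_add]
    have hll : ∀ x y, A *ᵥ cross x y = cross (A *ᵥ x) (A *ᵥ y) ∧
        C *ᵥ cross x y = cross (C *ᵥ x) (C *ᵥ y) := fun x y => by
      simpa [bra33, hl, cross_zero] using hΦ (x, 0) (y, 0)
    have hrr : ∀ x y, B *ᵥ cross x y = cross (B *ᵥ x) (B *ᵥ y) ∧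
        D *ᵥ cross x y = cross (D *ᵥ x) (D *ᵥ y) := fun x y => by
      simpa [bra33, hr, cross_zero] using hΦ (0, x) (0, y)
    have hlr : ∀ x y, cross (A *ᵥ x) (B *ᵥ y) = 0 ∧ cross (C *ᵥ x) (D *ᵥ y) = 0 := fun x y => by
      have := hΦ (x, 0) (0, y)
      simp only [bra33, hl, hr, cross_zero, zero_cross, Prod.mk_zero_zero, map_zero] at this
      exact ⟨(congrArg Prod.fst this).symm, (congrArg Prod.snd this).symm⟩
    have hAC : ¬ (A = 0 ∧ C = 0) := by
      rintro ⟨rfl, rfl⟩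
      have : Φ (1, 0) = Φ 0 := by rw [hl, map_zero, zero_mulVec, Prod.mk_zero_zero]
      simpa using congrArg Prod.fst (hinj this)
    have hBD : ¬ (B = 0 ∧ D = 0) := by
      rintro ⟨rfl, rfl⟩
      have : Φ (0, 1) = Φ 0 := by rw [hr, map_zero, zero_mulVec, Prod.mk_zero_zero]
      simpa using congrArg Prod.snd (hinj this)
    rcases eq_zero_or_so3_of_map_cross A fun x y => (hll x y).1 with hA0 | hA1
    · have hC1 := (eq_zero_or_so3_of_map_cross C fun x y => (hll x y).2).resolve_left
        fun hC0 => hAC ⟨hA0, hC0⟩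
      have hD0 := hC1.eq_zero_of_cross fun x y => (hlr x y).2
      have hB1 := (eq_zero_or_so3_of_map_cross B fun x y => (hrr x y).1).resolve_left
        fun hB0 => hBD ⟨hB0, hD0⟩
      exact Or.inr ⟨C, B, hC1, hB1, fun x y => by simp [hsplit, hA0, hD0]⟩
    · have hB0 := hA1.eq_zero_of_cross fun x y => (hlr x y).1
      have hD1 := (eq_zero_or_so3_of_map_cross D fun x y => (hrr x y).2).resolve_left
        fun hD0 => hBD ⟨hB0, hD0⟩
      have hC0 := hD1.eq_zero_of_cross fun x y => cross_eq_zero_comm (hlr y x).2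
      exact Or.inl ⟨A, D, hA1, hD1, fun x y => by simp [hsplit, hB0, hC0]⟩
  · rintro (⟨P, Q, hP, hQ, h⟩ | ⟨P, Q, hP, hQ, h⟩)
    · have hfun : ⇑Φ = Prod.map P.mulVec Q.mulVec := funext fun z => h z.1 z.2
      refine ⟨hfun ▸ hP.bijective.prodMap hQ.bijective, fun x y => ?_⟩
      simp only [hfun, bra33, Prod.map_apply, Prod.map_fst, Prod.map_snd, hP.map_cross,
        hQ.map_cross]
    · have hfun : ⇑Φ = Prod.swap ∘ Prod.map P.mulVec Q.mulVec := funext fun z => h z.1 z.2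
      refine ⟨hfun ▸ Prod.swap_bijective.comp (hP.bijective.prodMap hQ.bijective), fun x y => ?_⟩
      simp only [hfun, bra33, Function.comp_apply, Prod.map_apply, Prod.map_fst, Prod.map_snd,
        Prod.swap_prod_mk, Prod.fst_swap, Prod.snd_swap, hP.map_cross, hQ.map_cross]
end

section
/- A linear map J : su(2) ⊕ su(2) → su(2) ⊕ su(2) has zero torsion if and only if there exist Φ ∈ SO(3) × SO(3) (block-diagonal) and real numbers m₃₃, m₃₆, m₆₃, m₆₆ such that Φ⁻¹ J Φ is the 6×6 matrix with rows (0,1,0,0,0,0), (−1,0,0,0,0,0), (0,0,m₃₃,0,0,m₃₆), (0,0,0,0,1,0), (0,0,0,−1,0,0), (0,0,m₆₃,0,0,m₆₆). -/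
/-- The Lie bracket of su(2) ⊕ su(2) in the basis (J₁⁽¹⁾,J₂⁽¹⁾,J₃⁽¹⁾,J₁⁽²⁾,J₂⁽²⁾,J₃⁽²⁾):
the cross product on each group of three coordinates. -/
def bra6 (x y : Fin 6 → ℝ) : Fin 6 → ℝ :=
  ![x 1 * y 2 - x 2 * y 1, x 2 * y 0 - x 0 * y 2, x 0 * y 1 - x 1 * y 0,
    x 4 * y 5 - x 5 * y 4, x 5 * y 3 - x 3 * y 5, x 3 * y 4 - x 4 * y 3]

/-- `J` (as a 6×6 matrix) has zero torsion on su(2) ⊕ su(2). -/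
def torsion6 (J : Matrix (Fin 6) (Fin 6) ℝ) : Prop :=
  ∀ X Y : Fin 6 → ℝ,
    bra6 (J.mulVec X) (J.mulVec Y) - bra6 X Y
      - J.mulVec (bra6 (J.mulVec X) Y) - J.mulVec (bra6 X (J.mulVec Y)) = 0

/-- `J` is a complex structure on su(2) ⊕ su(2). -/
def isCx6 (J : Matrix (Fin 6) (Fin 6) ℝ) : Prop := J * J = -1 ∧ torsion6 J

/-- The block-diagonal 6×6 matrix diag(A, B), for A, B 3×3. -/
def diag33 (A B : Matrix (Fin 3) (Fin 3) ℝ) : Matrix (Fin 6) (Fin 6) ℝ :=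
  !![A 0 0, A 0 1, A 0 2, 0, 0, 0;
     A 1 0, A 1 1, A 1 2, 0, 0, 0;
     A 2 0, A 2 1, A 2 2, 0, 0, 0;
     0, 0, 0, B 0 0, B 0 1, B 0 2;
     0, 0, 0, B 1 0, B 1 1, B 1 2;
     0, 0, 0, B 2 0, B 2 1, B 2 2]

open Matrix

/-- The inverse of a special orthogonal matrix is its transpose, so its cofactors are its entries. -/
theorem so3.adjugate_eq {R : Matrix (Fin 3) (Fin 3) ℝ} (h : so3 R) : R.adjugate = Rᵀ := by
  have h1 : R.adjugate * (R * Rᵀ) = Rᵀ := by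
    rw [← Matrix.mul_assoc, Matrix.adjugate_mul, h.2, one_smul, Matrix.one_mul]
  rwa [h.1, Matrix.mul_one] at h1

/-- Every entry of a special orthogonal matrix equals its cofactor. -/
theorem so3.cofactors {R : Matrix (Fin 3) (Fin 3) ℝ} (h : so3 R) :
    (R 0 0 = R 1 1 * R 2 2 - R 1 2 * R 2 1 ∧ R 0 1 = R 1 2 * R 2 0 - R 1 0 * R 2 2 ∧
      R 0 2 = R 1 0 * R 2 1 - R 1 1 * R 2 0) ∧
    (R 1 0 = R 0 2 * R 2 1 - R 0 1 * R 2 2 ∧ R 1 1 = R 0 0 * R 2 2 - R 0 2 * R 2 0 ∧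
      R 1 2 = R 0 1 * R 2 0 - R 0 0 * R 2 1) ∧
    (R 2 0 = R 0 1 * R 1 2 - R 0 2 * R 1 1 ∧ R 2 1 = R 0 2 * R 1 0 - R 0 0 * R 1 2 ∧
      R 2 2 = R 0 0 * R 1 1 - R 0 1 * R 1 0) := by
  have key := fun i j => congrFun (congrFun h.adjugate_eq j) i
  simp only [Matrix.adjugate_fin_three, Matrix.transpose_apply] at key
  have h00 := key 0 0
  have h01 := key 0 1
  have h02 := key 0 2
  have h10 := key 1 0
  have h11 := key 1 1
  have h12 := key 1 2
  have h20 := key 2 0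
  have h21 := key 2 1
  have h22 := key 2 2
  simp at h00 h01 h02 h10 h11 h12 h20 h21 h22
  refine ⟨⟨?_, ?_, ?_⟩, ⟨?_, ?_, ?_⟩, ?_, ?_, ?_⟩ <;> linarith

/-- Block-diagonal rotations are automorphisms of the Lie algebra. -/
theorem bra6_diag33_mulVec {R S : Matrix (Fin 3) (Fin 3) ℝ} (hR : so3 R) (hS : so3 S)
    (x y : Fin 6 → ℝ) :
    bra6 (diag33 R S *ᵥ x) (diag33 R S *ᵥ y) = diag33 R S *ᵥ bra6 x y := by
  obtain ⟨⟨a1, a2, a3⟩, ⟨a4, a5, a6⟩, a7, a8, a9⟩ := hR.cofactors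
  obtain ⟨⟨b1, b2, b3⟩, ⟨b4, b5, b6⟩, b7, b8, b9⟩ := hS.cofactors
  funext i
  fin_cases i <;>
    simp [bra6, diag33, Matrix.mulVec, dotProduct, Fin.sum_univ_six]
  · linear_combination (-(x 1 * y 2 - x 2 * y 1)) * a1 - (x 2 * y 0 - x 0 * y 2) * a2
      - (x 0 * y 1 - x 1 * y 0) * a3
  · linear_combination (-(x 1 * y 2 - x 2 * y 1)) * a4 - (x 2 * y 0 - x 0 * y 2) * a5
      - (x 0 * y 1 - x 1 * y 0) * a6
  · linear_combination (-(x 1 * y 2 - x 2 * y 1)) * a7 - (x 2 * y 0 - x 0 * y 2) * a8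
      - (x 0 * y 1 - x 1 * y 0) * a9
  · linear_combination (-(x 4 * y 5 - x 5 * y 4)) * b1 - (x 5 * y 3 - x 3 * y 5) * b2
      - (x 3 * y 4 - x 4 * y 3) * b3
  · linear_combination (-(x 4 * y 5 - x 5 * y 4)) * b4 - (x 5 * y 3 - x 3 * y 5) * b5
      - (x 3 * y 4 - x 4 * y 3) * b6
  · linear_combination (-(x 4 * y 5 - x 5 * y 4)) * b7 - (x 5 * y 3 - x 3 * y 5) * b8
      - (x 3 * y 4 - x 4 * y 3) * b9

/-- Block-diagonal orthogonal matrices are orthogonal. -/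
theorem diag33_mul_transpose {R S : Matrix (Fin 3) (Fin 3) ℝ} (hR : so3 R) (hS : so3 S) :
    diag33 R S * (diag33 R S)ᵀ = 1 := by
  have r := fun i j => congrFun (congrFun hR.1 i) j
  have s := fun i j => congrFun (congrFun hS.1 i) j
  simp only [Matrix.mul_apply, Fin.sum_univ_three, Matrix.transpose_apply] at r s
  ext i j
  fin_cases i <;> fin_cases j <;>
    simp [diag33, Matrix.mul_apply, Fin.sum_univ_six, r, s]

/-- Zero torsion is invariant under conjugation by an automorphism of the Lie algebra. -/
theorem torsion6.conj {J P Q : Matrix (Fin 6) (Fin 6) ℝ} (hPQ : P * Q = 1)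
    (hP : ∀ x y, bra6 (P *ᵥ x) (P *ᵥ y) = P *ᵥ bra6 x y) (hJ : torsion6 J) :
    torsion6 (Q * J * P) := by
  have hQP : Q * P = 1 := mul_eq_one_comm.mp hPQ
  have hPJ : ∀ x, P *ᵥ ((Q * J * P) *ᵥ x) = J *ᵥ (P *ᵥ x) := fun x => by
    simp only [Matrix.mulVec_mulVec, ← Matrix.mul_assoc, hPQ, Matrix.one_mul]
  intro X Y
  have h := hJ (P *ᵥ X) (P *ᵥ Y)
  simp only [← hPJ, hP, ← Matrix.mulVec_sub] at h
  simpa [Matrix.mulVec_mulVec, hQP] using congrArg (Q *ᵥ ·) h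

/-- Any vector can be rotated to a nonnegative multiple of the third basis vector. -/
theorem exists_so3_align (a b c : ℝ) : ∃ R, so3 R ∧
    R 0 0 * a + R 1 0 * b + R 2 0 * c = 0 ∧ R 0 1 * a + R 1 1 * b + R 2 1 * c = 0 ∧
    0 ≤ R 0 2 * a + R 1 2 * b + R 2 2 * c := by
  by_cases hab : a ^ 2 + b ^ 2 = 0
  · have ha : a = 0 := by nlinarith [sq_nonneg a, sq_nonneg b]
    have hb : b = 0 := by nlinarith [sq_nonneg a, sq_nonneg b]
    subst ha hb
    rcases le_total 0 c with hc | hc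
    · exact ⟨1, by simp [so3], by simp [hc]⟩
    · refine ⟨!![1, 0, 0; 0, -1, 0; 0, 0, -1], ⟨?_, by simp [Matrix.det_fin_three]⟩, by simp [hc]⟩
      ext i j
      fin_cases i <;> fin_cases j <;> simp [Matrix.mul_apply, Fin.sum_univ_three]
  · have hpos : 0 < a ^ 2 + b ^ 2 := by positivity
    obtain ⟨r, hr, hr2⟩ : ∃ r : ℝ, 0 < r ∧ r ^ 2 = a ^ 2 + b ^ 2 :=
      ⟨√(a ^ 2 + b ^ 2), Real.sqrt_pos.mpr hpos, Real.sq_sqrt hpos.le⟩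
    obtain ⟨n, hn, hn2⟩ : ∃ n : ℝ, 0 < n ∧ n ^ 2 = a ^ 2 + b ^ 2 + c ^ 2 :=
      ⟨√(a ^ 2 + b ^ 2 + c ^ 2), Real.sqrt_pos.mpr (by positivity), Real.sq_sqrt (by positivity)⟩
    refine ⟨!![-b / r, -a * c / (r * n), a / n; a / r, -b * c / (r * n), b / n; 0, r / n, c / n],
      ⟨?_, ?_⟩, ?_, ?_, ?_⟩
    · ext i j
      fin_cases i <;> fin_cases j <;> simp [Matrix.mul_apply, Fin.sum_univ_three] <;> field_simp <;>
        grind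
    · simp [Matrix.det_fin_three]
      field_simp
      grind
    · simp
      field_simp
      ring
    · simp
      field_simp
      grind
    · have : a / n * a + b / n * b + c / n * c = n := by
        field_simp
        linarith
      simpa [this] using hn.le

/-- A zero-torsion map of su(2) whose antisymmetric part is a nonnegative rotation generator
about the third axis is in normal form. -/
theorem normal_form_su2 {a p c q d e f : ℝ} (hpq : 0 ≤ p - q)
    (h00 : d * f - e * e - 1 - (a + d + f) * a + (a * a + p * p + c * c) = 0)
    (h01 : e * c - q * f - (a + d + f) * p + (a * q + p * d + c * e) = 0)
    (h02 : q * e - d * c - (a + d + f) * c + (a * c + p * e + c * f) = 0)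
    (h10 : c * e - p * f - (a + d + f) * q + (a * q + p * d + c * e) = 0)
    (h11 : a * f - c * c - 1 - (a + d + f) * d + (q * q + d * d + e * e) = 0)
    (h12 : p * c - a * e - (a + d + f) * e + (q * c + d * e + e * f) = 0)
    (h20 : p * e - c * d - (a + d + f) * c + (a * c + p * e + c * f) = 0)
    (h21 : c * q - a * e - (a + d + f) * e + (q * c + d * e + e * f) = 0)
    (h22 : a * d - p * q - 1 - (a + d + f) * f + (c * c + e * e + f * f) = 0) :
    a = 0 ∧ p = 1 ∧ c = 0 ∧ q = -1 ∧ d = 0 ∧ e = 0 := by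
  rcases hpq.eq_or_lt with h | h
  · exfalso
    have hq : q = p := by linarith
    subst hq
    have h3 : a * d + a * f + d * f - q * q - c * c - e * e = -3 := by linarith
    have c00 : d * f - e * e = -1 := by linarith
    have c11 : a * f - c * c = -1 := by linarith
    have c22 : a * d - q * q = -1 := by linarith
    have c01 : c * e - q * f = 0 := by linarith
    have c02 : q * e - d * c = 0 := by linarith
    have c12 : q * c - a * e = 0 := by linarith
    have hq0 : q = 0 := by linear_combination a * c01 + q * c11 + c * c12
    have hc0 : c = 0 := by linear_combination a * c02 + q * c12 + c * c22
    have he0 : e = 0 := by linear_combination q * c02 + d * c12 + e * c22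
    subst hq0 hc0 he0
    have : (a * d * f) ^ 2 = -1 := by
      linear_combination (a * f * (a * d)) * c00 - (a * d) * c11 + c22
    nlinarith [sq_nonneg (a * d * f)]
  · have hne : p - q ≠ 0 := h.ne'
    have he : e = 0 := mul_left_cancel₀ hne (by linear_combination h20 - h02)
    have hc : c = 0 := mul_left_cancel₀ hne (by linear_combination h12 - h21)
    subst he hc
    have hd : d = -a := mul_left_cancel₀ hne (by linear_combination h10 - h01)
    subst hd
    have hsum : (p + q) ^ 2 + 4 * a ^ 2 = 0 := by linear_combination h00 + h11 - 2 * h22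
    have ha : a = 0 := by nlinarith [sq_nonneg (p + q), sq_nonneg a]
    have hq : q = -p := by nlinarith [sq_nonneg (p + q), sq_nonneg a]
    subst ha hq
    have hp : p = 1 := by nlinarith
    simp [hp]

/-- The off-diagonal block of a zero-torsion map sends the rotation plane of the diagonal block
to zero. -/
theorem vectors_eq_zero_of_cross {x₀ x₁ x₂ y₀ y₁ y₂ z₀ z₁ z₂ m : ℝ}
    (hx₀ : x₁ * z₂ - x₂ * z₁ = -x₀ - m * y₀) (hx₁ : x₂ * z₀ - x₀ * z₂ = -x₁ - m * y₁)
    (hx₂ : x₀ * z₁ - x₁ * z₀ = -x₂ - m * y₂) (hy₀ : y₁ * z₂ - y₂ * z₁ = -y₀ + m * x₀)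
    (hy₁ : y₂ * z₀ - y₀ * z₂ = -y₁ + m * x₁) (hy₂ : y₀ * z₁ - y₁ * z₀ = -y₂ + m * x₂) :
    (x₀ = 0 ∧ x₁ = 0 ∧ x₂ = 0) ∧ y₀ = 0 ∧ y₁ = 0 ∧ y₂ = 0 := by
  have h : x₀ ^ 2 + x₁ ^ 2 + x₂ ^ 2 + (y₀ ^ 2 + y₁ ^ 2 + y₂ ^ 2) = 0 := by
    linear_combination x₀ * hx₀ + x₁ * hx₁ + x₂ * hx₂ + y₀ * hy₀ + y₁ * hy₁ + y₂ * hy₂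
  refine ⟨⟨?_, ?_, ?_⟩, ?_, ?_, ?_⟩ <;>
    nlinarith [sq_nonneg x₀, sq_nonneg x₁, sq_nonneg x₂, sq_nonneg y₀, sq_nonneg y₁, sq_nonneg y₂]

theorem eq_zero_of_coupled {a b m : ℝ} (h : a - m * b = 0) (h' : b + m * a = 0) : a = 0 := by
  have : a * (1 + m ^ 2) = 0 := by linear_combination h + m * h'
  exact (mul_eq_zero.mp this).resolve_right (by positivity)

/-- A zero-torsion map whose diagonal blocks have antisymmetric parts that are nonnegative rotation
generators about the third axes is in normal form. -/
theorem torsion6.normal_form {J : Matrix (Fin 6) (Fin 6) ℝ} (hJ : torsion6 J)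
    (h20 : J 2 0 = J 0 2) (h21 : J 2 1 = J 1 2) (h01 : 0 ≤ J 0 1 - J 1 0)
    (h53 : J 5 3 = J 3 5) (h54 : J 5 4 = J 4 5) (h34 : 0 ≤ J 3 4 - J 4 3) :
    J = !![0, 1, 0, 0, 0, 0;
           -1, 0, 0, 0, 0, 0;
           0, 0, J 2 2, 0, 0, J 2 5;
           0, 0, 0, 0, 1, 0;
           0, 0, 0, -1, 0, 0;
           0, 0, J 5 2, 0, 0, J 5 5] := by
  have T := fun i j l => congrFun (hJ (Pi.single i 1) (Pi.single j 1)) l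
  simp only [Matrix.mulVec_single_one, Pi.sub_apply, Pi.zero_apply] at T
  simp only [bra6, Matrix.mulVec, dotProduct, Fin.sum_univ_six, Matrix.col_apply] at T
  have A0 := T 1 2
  have A1 := T 2 0
  have A2 := T 0 1
  have D0 := T 4 5
  have D1 := T 5 3
  have D2 := T 3 4
  have E0 := T 0 5 2
  have E1 := T 1 5 2
  have F0 := T 3 2 5
  have F1 := T 4 2 5
  clear T
  simp [Fin.forall_fin_succ, h20, h21, h53, h54] at A0 A1 A2 D0 D1 D2 E0 E1 F0 F1
  obtain ⟨a00, a10, a20, c00, c10, c20⟩ := A0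
  obtain ⟨a01, a11, a21, c01, c11, c21⟩ := A1
  obtain ⟨a02, a12, a22, -⟩ := A2
  obtain ⟨v00, v01, v02, v10, v11, v12⟩ := normal_form_su2
    (a := J 0 0) (c := J 0 2) (d := J 1 1) (e := J 1 2) (f := J 2 2) h01
    (by linear_combination a00) (by linear_combination a01) (by linear_combination a02)
    (by linear_combination a10) (by linear_combination a11) (by linear_combination a12)
    (by linear_combination a20) (by linear_combination a21) (by linear_combination a22)
  simp only [v00, v01, v02, v10, v11, v12] at c00 c10 c20 c01 c11 c21 E0 E1
  obtain ⟨⟨v30, v40, v50⟩, v31, v41, v51⟩ :=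
    vectors_eq_zero_of_cross (m := J 2 2)
      (x₀ := J 3 0) (x₁ := J 4 0) (x₂ := J 5 0)
      (y₀ := J 3 1) (y₁ := J 4 1) (y₂ := J 5 1)
      (z₀ := J 3 2) (z₁ := J 4 2) (z₂ := J 5 2)
      (by linear_combination -c01) (by linear_combination -c11) (by linear_combination -c21)
      (by linear_combination c00) (by linear_combination c10) (by linear_combination c20)
  clear a00 a10 a20 a01 a11 a21 a02 a12 a22 c00 c10 c20 c01 c11 c21
  obtain ⟨c00, c10, c20, a00, a10, a20⟩ := D0
  obtain ⟨c01, c11, c21, a01, a11, a21⟩ := D1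
  obtain ⟨-, -, -, a02, a12, a22⟩ := D2
  obtain ⟨v33, v34, v35, v43, v44, v45⟩ := normal_form_su2
    (a := J 3 3) (c := J 3 5) (d := J 4 4) (e := J 4 5) (f := J 5 5) h34
    (by linear_combination a00) (by linear_combination a01) (by linear_combination a02)
    (by linear_combination a10) (by linear_combination a11) (by linear_combination a12)
    (by linear_combination a20) (by linear_combination a21) (by linear_combination a22)
  simp only [v33, v34, v35, v43, v44, v45] at c00 c10 c20 c01 c11 c21 F0 F1
  obtain ⟨⟨v03, v13, v23⟩, v04, v14, v24⟩ :=
    vectors_eq_zero_of_cross (m := J 5 5)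
      (x₀ := J 0 3) (x₁ := J 1 3) (x₂ := J 2 3)
      (y₀ := J 0 4) (y₁ := J 1 4) (y₂ := J 2 4)
      (z₀ := J 0 5) (z₁ := J 1 5) (z₂ := J 2 5)
      (by linear_combination -c01) (by linear_combination -c11) (by linear_combination -c21)
      (by linear_combination c00) (by linear_combination c10) (by linear_combination c20)
  clear a00 a10 a20 a01 a11 a21 a02 a12 a22 c00 c10 c20 c01 c11 c21
  simp only [v30, v40, v50, v31, v41, v51,
    v03, v13, v23, v04, v14, v24] at E0 E1 F0 F1
  have v05 : J 0 5 = 0 := eq_zero_of_coupled (b := J 1 5) (m := J 2 2)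
    (by linear_combination E0) (by linear_combination E1)
  have v15 : J 1 5 = 0 := eq_zero_of_coupled (b := J 0 5) (m := -J 2 2)
    (by linear_combination E1) (by linear_combination E0)
  have v32 : J 3 2 = 0 := eq_zero_of_coupled (b := J 4 2) (m := J 5 5)
    (by linear_combination F0) (by linear_combination F1)
  have v42 : J 4 2 = 0 := eq_zero_of_coupled (b := J 3 2) (m := -J 5 5)
    (by linear_combination F1) (by linear_combination F0)
  ext i j
  fin_cases i <;> fin_cases j <;>
    simp [v00, v01, v02, v10, v11, v12, v30, v40, v50, v31, v41, v51, v33, v34, v35, v43,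
      v44, v45, v03, v13, v23, v04, v14, v24, v05, v15, v32, v42, h20, h21, h53, h54]

/-- The normal form has zero torsion. -/
theorem torsion6_normal_form (m33 m36 m63 m66 : ℝ) :
    torsion6 !![0, 1, 0, 0, 0, 0;
                -1, 0, 0, 0, 0, 0;
                0, 0, m33, 0, 0, m36;
                0, 0, 0, 0, 1, 0;
                0, 0, 0, -1, 0, 0;
                0, 0, m63, 0, 0, m66] := by
  intro X Y
  have hm : ∀ v : Fin 6 → ℝ, !![0, 1, 0, 0, 0, 0;
                -1, 0, 0, 0, 0, 0;
                0, 0, m33, 0, 0, m36;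
                0, 0, 0, 0, 1, 0;
                0, 0, 0, -1, 0, 0;
                0, 0, m63, 0, 0, m66] *ᵥ v =
      ![v 1, -v 0, m33 * v 2 + m36 * v 5, v 4, -v 3, m63 * v 2 + m66 * v 5] := fun v => by
    funext i
    fin_cases i <;> simp [Matrix.mulVec, dotProduct, Fin.sum_univ_six]
  simp only [hm, bra6]
  funext i
  fin_cases i <;> simp <;> ring

/-- A linear map on su(2) ⊕ su(2) has zero torsion iff it is conjugate under some
block-diagonal element of SO(3) × SO(3) to the displayed normal form. -/
theorem stmt9 (J : Matrix (Fin 6) (Fin 6) ℝ) :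
    torsion6 J ↔
      ∃ (Φ₁ Φ₂ : Matrix (Fin 3) (Fin 3) ℝ) (m33 m36 m63 m66 : ℝ), so3 Φ₁ ∧ so3 Φ₂ ∧
        (diag33 Φ₁ Φ₂)⁻¹ * J * diag33 Φ₁ Φ₂ =
          !![0, 1, 0, 0, 0, 0;
             -1, 0, 0, 0, 0, 0;
             0, 0, m33, 0, 0, m36;
             0, 0, 0, 0, 1, 0;
             0, 0, 0, -1, 0, 0;
             0, 0, m63, 0, 0, m66] := by
  constructor
  · intro hJ
    obtain ⟨R, hR, hR0, hR1, hR2⟩ :=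
      exists_so3_align (J 1 2 - J 2 1) (J 2 0 - J 0 2) (J 0 1 - J 1 0)
    obtain ⟨S, hS, hS0, hS1, hS2⟩ :=
      exists_so3_align (J 4 5 - J 5 4) (J 5 3 - J 3 5) (J 3 4 - J 4 3)
    have hP := diag33_mul_transpose hR hS
    obtain ⟨⟨a1, a2, a3⟩, ⟨a4, a5, a6⟩, a7, a8, a9⟩ := hR.cofactors
    obtain ⟨⟨b1, b2, b3⟩, ⟨b4, b5, b6⟩, b7, b8, b9⟩ := hS.cofactors
    have hT := hJ.conj hP (bra6_diag33_mulVec hR hS)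
    rw [← Matrix.inv_eq_right_inv hP] at hT
    refine ⟨R, S, _, _, _, _, hR, hS, hT.normal_form ?_ ?_ ?_ ?_ ?_ ?_⟩ <;>
      rw [Matrix.inv_eq_right_inv hP] <;>
      simp only [diag33, Matrix.mul_apply, Fin.sum_univ_six, Matrix.transpose_apply] <;> simp
    · rw [a2, a5, a8] at hR1
      linear_combination hR1
    · rw [a1, a4, a7] at hR0
      linear_combination -hR0
    · rw [a3, a6, a9] at hR2
      linarith
    · rw [b2, b5, b8] at hS1
      linear_combination hS1
    · rw [b1, b4, b7] at hS0
      linear_combination -hS0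
    · rw [b3, b6, b9] at hS2
      linarith
  · rintro ⟨R, S, m33, m36, m63, m66, hR, hS, h⟩
    have hP := diag33_mul_transpose hR hS
    rw [Matrix.inv_eq_right_inv hP] at h
    have hQ : (diag33 R S)ᵀ * diag33 R S = 1 := mul_eq_one_comm.mp hP
    have hbra : ∀ x y, bra6 ((diag33 R S)ᵀ *ᵥ x) ((diag33 R S)ᵀ *ᵥ y) =
        (diag33 R S)ᵀ *ᵥ bra6 x y := fun x y => by
      have := bra6_diag33_mulVec hR hS ((diag33 R S)ᵀ *ᵥ x) ((diag33 R S)ᵀ *ᵥ y)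
      simp only [Matrix.mulVec_mulVec, hP, Matrix.one_mulVec] at this
      simp [this, Matrix.mulVec_mulVec, hQ]
    have hJ := (torsion6_normal_form m33 m36 m63 m66).conj hQ hbra
    rw [← h] at hJ
    simpa [← Matrix.mul_assoc, hP, Matrix.mul_assoc _ (diag33 R S)] using hJ
end

section
/- Let ξ, ξ′ ∈ ℝ and η, η′ ∈ ℝ ∖ {0}. Then J(ξ,η) and J(ξ′,η′) are conjugate by some element of SO(3) × SO(3) if and only if ξ′ = ξ and η′ = η; and they are conjugate by some element of τ(SO(3) × SO(3)) if and only if ξ′ = −ξ and η′ = −(1+ξ²)/η. -/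
/-- The normal form J(ξ,η). -/
noncomputable def Jxe (ξ η : ℝ) : Matrix (Fin 6) (Fin 6) ℝ :=
  !![0, 1, 0, 0, 0, 0;
     -1, 0, 0, 0, 0, 0;
     0, 0, ξ, 0, 0, η;
     0, 0, 0, 0, 1, 0;
     0, 0, 0, -1, 0, 0;
     0, 0, -(1 + ξ ^ 2) / η, 0, 0, -ξ]

/-- The swap τ of the two su(2) factors, as a 6×6 matrix. -/
def tau6 : Matrix (Fin 6) (Fin 6) ℝ :=
  !![0, 0, 0, 1, 0, 0;
     0, 0, 0, 0, 1, 0;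
     0, 0, 0, 0, 0, 1;
     1, 0, 0, 0, 0, 0;
     0, 1, 0, 0, 0, 0;
     0, 0, 1, 0, 0, 0]

/-- A block-diagonal matrix with special orthogonal blocks is invertible. -/
lemma isUnit_det_diag33 {A B : Matrix (Fin 3) (Fin 3) ℝ} (hA : so3 A) (hB : so3 B) :
    IsUnit (diag33 A B).det := by
  have h : diag33 A B * diag33 A.transpose B.transpose = 1 := by
    have mul_apply_one : ∀ {M : Matrix (Fin 3) (Fin 3) ℝ}, so3 M → ∀ i j : Fin 3,
        M i 0 * M j 0 + M i 1 * M j 1 + M i 2 * M j 2 = (1 : Matrix (Fin 3) (Fin 3) ℝ) i j := by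
      intro M hM i j
      rw [← hM.1, Matrix.mul_apply, Fin.sum_univ_three]
      rfl
    have eA := mul_apply_one hA
    have eB := mul_apply_one hB
    ext i j
    fin_cases i <;> fin_cases j <;>
      simp [diag33, Matrix.mul_apply, Fin.sum_univ_six, eA, eB]
  exact Matrix.isUnit_det_of_right_inverse h

/-- A special orthogonal matrix fixing the third axis up to sign, and commuting with the
quarter turn about it, fixes that axis pointwise. -/
lemma so3_apply_two_two_eq_one {R : Matrix (Fin 3) (Fin 3) ℝ} (hR : so3 R)
    (h02 : R 0 2 = 0) (h12 : R 1 2 = 0) (h20 : R 2 0 = 0) (h21 : R 2 1 = 0)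
    (h11 : R 1 1 = R 0 0) (h10 : R 1 0 = -R 0 1) : R 2 2 = 1 := by
  have hdet := hR.2
  have hsq : (R * R.transpose) 2 2 = 1 := by rw [hR.1]; rfl
  rw [Matrix.mul_apply, Fin.sum_univ_three] at hsq
  rw [Matrix.det_fin_three] at hdet
  simp only [Matrix.transpose_apply, h02, h12, h20, h21, h11, h10] at hsq hdet
  rcases mul_self_eq_one_iff.mp (by linarith : R 2 2 * R 2 2 = 1) with h | h
  · exact h
  · rw [h] at hdet
    nlinarith [sq_nonneg (R 0 0), sq_nonneg (R 0 1)]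

/-- If an element of SO(3) × SO(3) intertwines two normal forms, they are equal. -/
lemma eq_of_Jxe_mul_diag33 {ξ ξ' η η' : ℝ} (hη : η ≠ 0) (hη' : η' ≠ 0)
    {A B : Matrix (Fin 3) (Fin 3) ℝ} (hA : so3 A) (hB : so3 B)
    (h : Jxe ξ' η' * diag33 A B = diag33 A B * Jxe ξ η) : ξ' = ξ ∧ η' = η := by
  have hneg : ∀ x : ℝ, -x ^ 2 + -1 ≠ 0 := fun x => by nlinarith [sq_nonneg x]
  have e := fun i j => congrFun (congrFun h i) j
  simp only [Matrix.mul_apply, Fin.sum_univ_six] at e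
  have e00 := e 0 0
  have e01 := e 0 1
  have e33 := e 3 3
  have e34 := e 3 4
  have e05 := e 0 5
  have e15 := e 1 5
  have e23 := e 2 3
  have e24 := e 2 4
  have e25 := e 2 5
  have e22 := e 2 2
  have e32 := e 3 2
  have e42 := e 4 2
  have e50 := e 5 0
  have e51 := e 5 1
  simp [Jxe, diag33, hη, hη'] at e00 e01 e33 e34 e05 e15 e23 e24
  simp [Jxe, diag33, hη, hη', hneg] at e25 e22 e32 e42 e50 e51
  have hA22 := so3_apply_two_two_eq_one hA (by tauto) (by tauto) (by tauto) (by tauto)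
    (by linarith) (by linarith)
  have hB22 := so3_apply_two_two_eq_one hB (by tauto) (by tauto) (by tauto) (by tauto)
    (by linarith) (by linarith)
  rw [hA22, hB22] at e25
  rw [hA22] at e22
  constructor <;> linarith

/-- The swap is an involution. -/
lemma tau6_mul_tau6 : tau6 * tau6 = 1 := by
  ext i j
  fin_cases i <;> fin_cases j <;> simp [tau6, Matrix.mul_apply, Fin.sum_univ_six]

/-- The swap carries a normal form to another normal form. -/
lemma Jxe_mul_tau6 (ξ : ℝ) {η : ℝ} (hη : η ≠ 0) :
    Jxe ξ η * tau6 = tau6 * Jxe (-ξ) (-(1 + ξ ^ 2) / η) := by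
  have hpos : 1 + ξ ^ 2 ≠ 0 := by positivity
  have hinv : -(1 + (-ξ) ^ 2) / (-(1 + ξ ^ 2) / η) = η := by
    rw [neg_sq]
    field_simp
  unfold Jxe
  rw [hinv]
  ext i j
  fin_cases i <;> fin_cases j <;> simp [tau6, Matrix.mul_apply, Fin.sum_univ_six]

/-- The identity is special orthogonal. -/
lemma so3_one : so3 1 := by simp [so3]

/-- The block-diagonal matrix of two identities is the identity. -/
lemma diag33_one_one : diag33 1 1 = 1 := by
  ext i j
  fin_cases i <;> fin_cases j <;> simp [diag33]

/-- Conjugation by an invertible matrix, written as an intertwining relation. -/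
lemma eq_conj_iff {n : Type*} [Fintype n] [DecidableEq n] {M N P : Matrix n n ℝ}
    (hP : IsUnit P.det) : M = P * N * P⁻¹ ↔ M * P = P * N := by
  constructor
  · rintro rfl
    exact Matrix.nonsing_inv_mul_cancel_right _ _ hP
  · intro h
    rw [← h, Matrix.mul_nonsing_inv_cancel_right _ _ hP]

/-- J(ξ,η) and J(ξ′,η′) are conjugate under SO(3) × SO(3) iff ξ′ = ξ and η′ = η, and
conjugate under τ(SO(3) × SO(3)) iff ξ′ = −ξ and η′ = −(1+ξ²)/η. -/
theorem stmt11 (ξ ξ' η η' : ℝ) (hη : η ≠ 0) (hη' : η' ≠ 0) :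
    ((∃ Φ₁ Φ₂ : Matrix (Fin 3) (Fin 3) ℝ, so3 Φ₁ ∧ so3 Φ₂ ∧
        Jxe ξ' η' = diag33 Φ₁ Φ₂ * Jxe ξ η * (diag33 Φ₁ Φ₂)⁻¹) ↔ (ξ' = ξ ∧ η' = η)) ∧
    ((∃ Φ₁ Φ₂ : Matrix (Fin 3) (Fin 3) ℝ, so3 Φ₁ ∧ so3 Φ₂ ∧
        Jxe ξ' η' = (tau6 * diag33 Φ₁ Φ₂) * Jxe ξ η * (tau6 * diag33 Φ₁ Φ₂)⁻¹) ↔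
      (ξ' = -ξ ∧ η' = -(1 + ξ ^ 2) / η)) := by
  have hτ : IsUnit tau6.det := Matrix.isUnit_det_of_right_inverse tau6_mul_tau6
  refine ⟨⟨?_, ?_⟩, ⟨?_, ?_⟩⟩
  · rintro ⟨A, B, hA, hB, h⟩
    exact eq_of_Jxe_mul_diag33 hη hη' hA hB ((eq_conj_iff (isUnit_det_diag33 hA hB)).mp h)
  · rintro ⟨rfl, rfl⟩
    exact ⟨1, 1, so3_one, so3_one, by simp [diag33_one_one]⟩
  · rintro ⟨A, B, hA, hB, h⟩
    have hunit : IsUnit (tau6 * diag33 A B).det := by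
      rw [Matrix.det_mul]
      exact hτ.mul (isUnit_det_diag33 hA hB)
    rw [eq_conj_iff hunit, ← mul_assoc, Jxe_mul_tau6 ξ' hη', mul_assoc, mul_assoc] at h
    have hcancel := congrArg (tau6 * ·) h
    simp only [← mul_assoc tau6 tau6, tau6_mul_tau6, one_mul] at hcancel
    have hpos : 1 + ξ' ^ 2 ≠ 0 := by positivity
    obtain ⟨h1, h2⟩ := eq_of_Jxe_mul_diag33 hη
      (div_ne_zero (neg_ne_zero.mpr hpos) hη') hA hB hcancel
    refine ⟨by linarith, ?_⟩
    rw [← h2, ← h1, neg_sq]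
    field_simp
  · rintro ⟨rfl, rfl⟩
    refine ⟨1, 1, so3_one, so3_one, ?_⟩
    rw [diag33_one_one, mul_one, eq_conj_iff hτ, Jxe_mul_tau6 _ hη']
    have hpos : 1 + ξ ^ 2 ≠ 0 := by positivity
    congr 2
    · ring
    · rw [neg_sq]
      field_simp
end

section
/- A 6×6 real matrix is a complex structure on su(2) ⊕ su(2) if and only if there exist ξ ∈ ℝ, η ∈ ℝ ∖ {0}, and unit vectors (λ₁,μ₁,ν₁), (λ₂,μ₂,ν₂) ∈ S² ⊂ ℝ³ such that, writing K = (ξ²+1)/η, the matrix has rows: (λ₁²ξ, −λ₁μ₁ξ+ν₁, λ₁ν₁ξ+μ₁, ηλ₁λ₂, −ηλ₁μ₂, ηλ₁ν₂); (−λ₁μ₁ξ−ν₁, μ₁²ξ, λ₁−μ₁ν₁ξ, −ημ₁λ₂, ημ₁μ₂, −ημ₁ν₂); (λ₁ν₁ξ−μ₁, −λ₁−μ₁ν₁ξ, ν₁²ξ, ην₁λ₂, −ην₁μ₂, ην₁ν₂); (−Kλ₁λ₂, Kμ₁λ₂, −Kν₁λ₂, −λ₂²ξ, λ₂μ₂ξ+ν₂,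 −λ₂ν₂ξ+μ₂); (Kλ₁μ₂, −Kμ₁μ₂, Kν₁μ₂, λ₂μ₂ξ−ν₂, −μ₂²ξ, λ₂+μ₂ν₂ξ); (−Kλ₁ν₂, Kμ₁ν₂, −Kν₁ν₂, −λ₂ν₂ξ−μ₂, −λ₂+μ₂ν₂ξ, −ν₂²ξ). -/
open Matrix

namespace SuTwo

lemma adjugate_eq (A : Matrix (Fin 3) (Fin 3) ℝ) :
    A.adjugate = A * A - A.trace • A + ((A.trace ^ 2 - (A * A).trace) / 2) • 1 := by
  ext i j
  fin_cases i <;> fin_cases j <;>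
    simp [adjugate_fin_three, Matrix.mul_apply, Fin.sum_univ_three, Matrix.trace] <;> ring

lemma exists_vecMulVec_of_adjugate_eq_zero {C : Matrix (Fin 3) (Fin 3) ℝ}
    (hadj : C.adjugate = 0) (hC : C ≠ 0) :
    ∃ c u : Fin 3 → ℝ, c ≠ 0 ∧ u ⬝ᵥ u = 1 ∧ C = vecMulVec c u := by
  have hminor : ∀ i j k l, C k l * C i j = C k j * C i l := by
    have h : ∀ i j, C.adjugate i j = 0 := fun i j => by rw [hadj]; rfl
    simp [adjugate_fin_three, Fin.forall_fin_succ] at h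
    intro i j k l
    fin_cases i <;> fin_cases j <;> fin_cases k <;> fin_cases l <;> simp <;> grind
  obtain ⟨i, j, hij⟩ : ∃ i j, C i j ≠ 0 := by
    by_contra! h
    exact hC (Matrix.ext h)
  have hpos : 0 < C i ⬝ᵥ C i := by
    have hne : C i ≠ 0 := fun h => hij (congrFun h j)
    simpa using Matrix.dotProduct_star_self_pos_iff.mpr hne
  set s := √(C i ⬝ᵥ C i)
  have hs : 0 < s := Real.sqrt_pos.mpr hpos
  have hss : s * s = C i ⬝ᵥ C i := Real.mul_self_sqrt hpos.le
  refine ⟨fun k => s * C k j / C i j, s⁻¹ • C i, fun h => ?_, ?_, ?_⟩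
  · have := congrFun h i
    simp [hij, hs.ne'] at this
  · rw [smul_dotProduct, dotProduct_smul, ← hss]
    simp only [smul_eq_mul]
    field_simp
  · ext k l
    simp only [vecMulVec_apply, Pi.smul_apply, smul_eq_mul]
    field_simp
    exact hminor i j k l

/-- The relations satisfied by the block `A` on one ideal and the off-diagonal block `C` out of
it, for a complex structure with blocks `A, B, C, D`. -/
structure BlockRel (A B C D : Matrix (Fin 3) (Fin 3) ℝ) : Prop where
  diag : A.adjugateᵀ = 1 + A * (A.trace • 1 - Aᵀ)
  offDiag : C.adjugateᵀ = C * (A.trace • 1 - Aᵀ)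
  sq_diag : A * A + B * C = -1
  sq_offDiag : C * A + D * C = 0

variable {A B C D : Matrix (Fin 3) (Fin 3) ℝ}

lemma not_isSymm (h : A.adjugateᵀ = 1 + A * (A.trace • 1 - Aᵀ)) : Aᵀ ≠ A := by
  intro hA
  have hadj : A.adjugateᵀ = A.adjugate := by rw [adjugate_transpose, hA]
  have hCH := adjugate_eq A
  rw [hadj, hA, mul_sub, mul_smul_comm, mul_one] at h
  set c := (A.trace ^ 2 - (A * A).trace) / 2 with hc
  have h2 : (2 : ℝ) • A.adjugate = (1 + c) • (1 : Matrix (Fin 3) (Fin 3) ℝ) := by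
    rw [two_smul]
    nth_rewrite 1 [h]
    rw [hCH, add_smul, one_smul]
    abel
  have htr : A.adjugate.trace = c := by
    rw [hCH]
    simp [Matrix.trace_add, Matrix.trace_sub, Matrix.trace_smul]
    linear_combination -2 * hc
  have h3 : c = -3 := by
    have := congrArg Matrix.trace h2
    simp [Matrix.trace_smul, htr] at this
    linarith
  have h4 : A.adjugate = (-1 : ℝ) • 1 := by
    have : A.adjugate = (2⁻¹ : ℝ) • (2 : ℝ) • A.adjugate := by simp [smul_smul]
    rw [this, h2, smul_smul, h3]
    norm_num
  have h5 := det_adjugate A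
  rw [h4, det_smul] at h5
  simp at h5
  nlinarith [sq_nonneg A.det]

lemma BlockRel.det_eq_zero (h : BlockRel A B C D) : C.det = 0 := by
  by_contra hdet
  have hN : Cᵀ * C * (A.trace • 1 - Aᵀ) = C.det • 1 := by
    rw [mul_assoc, ← h.offDiag, ← transpose_mul, adjugate_mul, transpose_smul, transpose_one]
  have hG : IsUnit (Cᵀ * C).det := by simp [hdet]
  have hN' : A.trace • 1 - Aᵀ = C.det • (Cᵀ * C)⁻¹ := by
    rw [← nonsing_inv_mul_cancel_left (Cᵀ * C) (A.trace • 1 - Aᵀ) hG, hN, mul_smul_comm, mul_one]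
  have hA : Aᵀ = A.trace • 1 - C.det • (Cᵀ * C)⁻¹ := by rw [← hN']; abel
  refine not_isSymm h.diag ?_
  have hA' := congrArg transpose hA
  simp only [transpose_transpose, transpose_sub, transpose_smul, transpose_one,
    transpose_nonsing_inv, transpose_mul] at hA'
  rw [hA, ← hA']

lemma BlockRel.adjugate_eq_zero (h : BlockRel A B C D) : C.adjugate = 0 := by
  have h1 : C.adjugate * C.adjugateᵀ = 0 := by
    rw [h.offDiag, ← mul_assoc, adjugate_mul, h.det_eq_zero, zero_smul, zero_mul]
  have h2 : C.adjugate * C.adjugateᴴ = 0 := by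
    simpa [conjTranspose_eq_transpose_of_trivial] using h1
  exact self_mul_conjTranspose_eq_zero.mp h2

lemma BlockRel.ne_zero (h : BlockRel A B C D) : C ≠ 0 := by
  rintro rfl
  have := congrArg det h.sq_diag
  simp [det_neg] at this
  nlinarith [sq_nonneg A.det]

lemma BlockRel.exists_vecMulVec (h : BlockRel A B C D) :
    ∃ c u : Fin 3 → ℝ, u ⬝ᵥ u = 1 ∧ C = vecMulVec c u ∧ A *ᵥ u = A.trace • u ∧
      u ᵥ* A = A.trace • u ∧ D *ᵥ c = -A.trace • c := by
  obtain ⟨c, u, hc, hu, hC⟩ := exists_vecMulVec_of_adjugate_eq_zero h.adjugate_eq_zero h.ne_zero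
  obtain ⟨k, hk⟩ := Function.ne_iff.mp hc
  have hAu : A *ᵥ u = A.trace • u := by
    have h1 := h.offDiag
    rw [h.adjugate_eq_zero, hC, vecMulVec_mul, transpose_zero] at h1
    have h2 : u ᵥ* (A.trace • 1 - Aᵀ) = 0 := by
      funext l
      have := congrFun (congrFun h1 k) l
      exact (mul_eq_zero.mp (this.symm : c k * _ = 0)).resolve_left hk
    rw [vecMul_sub, vecMul_smul, vecMul_one, vecMul_transpose] at h2
    exact (sub_eq_zero.mp h2).symm
  have h3 : vecMulVec c (u ᵥ* A) + vecMulVec (D *ᵥ c) u = 0 := by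
    rw [← vecMulVec_mul, ← mul_vecMulVec, ← hC, h.sq_offDiag]
  have hDc : D *ᵥ c = -A.trace • c := by
    have := congrArg (· *ᵥ u) h3
    simp only [add_mulVec, vecMulVec_mulVec, ← dotProduct_mulVec, hAu, dotProduct_smul, hu,
      zero_mulVec] at this
    simp at this
    rw [neg_smul]
    exact (neg_eq_of_add_eq_zero_right this).symm
  refine ⟨c, u, hu, hC, hAu, ?_, hDc⟩
  rw [hDc] at h3
  funext l
  have := congrFun (congrFun h3 k) l
  simp [vecMulVec_apply] at this
  have h4 : c k * ((u ᵥ* A) l - A.trace * u l) = 0 := by linear_combination this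
  exact sub_eq_zero.mp ((mul_eq_zero.mp h4).resolve_left hk)

/-- The matrix of the cross product `w ↦ u × w`. -/
def crossMatrix (u : Fin 3 → ℝ) : Matrix (Fin 3) (Fin 3) ℝ :=
  !![0, -u 2, u 1; u 2, 0, -u 0; -u 1, u 0, 0]

lemma diag_block_eq {u : Fin 3 → ℝ} (hu : u ⬝ᵥ u = 1)
    (hdiag : A.adjugateᵀ = 1 + A * (A.trace • 1 - Aᵀ)) (hAu : A *ᵥ u = A.trace • u)
    (huA : u ᵥ* A = A.trace • u)
    (hsq : A * A = -1 + (1 + A.trace ^ 2) • vecMulVec u u) :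
    ∃ t : ℝ, t ^ 2 = 1 ∧ A = A.trace • vecMulVec u u + t • crossMatrix u := by
  set ξ := A.trace with hξ
  have htr : (A * A).trace = ξ ^ 2 - 2 := by
    rw [hsq, trace_add, trace_smul, trace_vecMulVec, hu]
    simp
    ring
  have hCH := adjugate_eq A
  rw [htr, ← hξ] at hCH
  have hsqT : Aᵀ * Aᵀ = -1 + (1 + ξ ^ 2) • vecMulVec u u := by
    rw [← transpose_mul, hsq]
    simp [transpose_vecMulVec]
  have hfac : (A + Aᵀ) * (Aᵀ - ξ • 1) = 0 := by
    rw [hCH] at hdiag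
    simp only [transpose_add, transpose_sub, transpose_mul, transpose_smul, transpose_one,
      mul_sub, mul_smul_comm, mul_one] at hdiag
    have : (ξ ^ 2 - (ξ ^ 2 - 2)) / 2 = 1 := by ring
    rw [this, one_smul] at hdiag
    rw [mul_sub, add_mul, mul_smul_comm, mul_one, smul_add]
    have h0 := sub_eq_zero.mpr hdiag
    rw [← h0]
    abel
  have hsymm : A + Aᵀ = (2 * ξ) • vecMulVec u u := by
    have h1 : (A + Aᵀ) * ((Aᵀ - ξ • 1) * (Aᵀ + ξ • 1)) = 0 := by
      rw [← mul_assoc, hfac, zero_mul]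
    have h2 : (Aᵀ - ξ • 1) * (Aᵀ + ξ • 1) =
        (1 + ξ ^ 2) • (vecMulVec u u - (1 : Matrix (Fin 3) (Fin 3) ℝ)) := by
      rw [sub_mul, mul_add, hsqT]
      ext i j
      simp
      ring
    have h3 : (1 + ξ ^ 2) ≠ 0 := by positivity
    rw [h2, mul_smul_comm, smul_eq_zero_iff_right h3, mul_sub, mul_one, mul_vecMulVec, add_mulVec,
      mulVec_transpose, hAu, huA, sub_eq_zero] at h1
    rw [← h1, ← add_smul, smul_vecMulVec]
    ring_nf
  have hS : ∀ i j, A i j + A j i = 2 * ξ * (u i * u j) := fun i j => by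
    have := congrFun (congrFun hsymm i) j
    simpa [vecMulVec_apply] using this
  have hK : ∀ i, A i 0 * u 0 + A i 1 * u 1 + A i 2 * u 2 = ξ * u i := fun i => by
    have := congrFun hAu i
    simpa [mulVec, dotProduct, Fin.sum_univ_three] using this
  have hu' : u 0 * u 0 + u 1 * u 1 + u 2 * u 2 = 1 := by
    simpa [dotProduct, Fin.sum_univ_three] using hu
  obtain ⟨p, hp⟩ : ∃ p, p = A 2 1 - ξ * (u 2 * u 1) := ⟨_, rfl⟩
  obtain ⟨q, hq⟩ : ∃ q, q = A 0 2 - ξ * (u 0 * u 2) := ⟨_, rfl⟩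
  obtain ⟨r, hr⟩ : ∃ r, r = A 1 0 - ξ * (u 1 * u 0) := ⟨_, rfl⟩
  have hqr : q * u 2 = r * u 1 := by
    linear_combination hK 0 + u 2 * hq - u 1 * hr - u 0 / 2 * hS 0 0 - u 1 * hS 0 1 -
      ξ * u 0 * hu'
  have hrp : r * u 0 = p * u 2 := by
    linear_combination hK 1 + u 0 * hr - u 2 * hp - u 1 / 2 * hS 1 1 - u 2 * hS 1 2 -
      ξ * u 1 * hu'
  have hpq : p * u 1 = q * u 0 := by
    linear_combination hK 2 + u 1 * hp - u 0 * hq - u 2 / 2 * hS 2 2 - u 0 * hS 2 0 -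
      ξ * u 2 * hu'
  obtain ⟨t, ht⟩ : ∃ t, t = p * u 0 + q * u 1 + r * u 2 := ⟨_, rfl⟩
  have hpt : p = t * u 0 := by
    linear_combination u 1 * hpq - u 2 * hrp - p * hu' - u 0 * ht
  have hqt : q = t * u 1 := by
    linear_combination u 2 * hqr - u 0 * hpq - q * hu' - u 1 * ht
  have hrt : r = t * u 2 := by
    linear_combination u 0 * hrp - u 1 * hqr - r * hu' - u 2 * ht
  have hA : A = ξ • vecMulVec u u + t • crossMatrix u := by
    have h00 := hS 0 0
    have h11 := hS 1 1
    have h22 := hS 2 2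
    have h01 := hS 0 1
    have h02 := hS 0 2
    have h12 := hS 1 2
    ext i j
    fin_cases i <;> fin_cases j <;> simp [crossMatrix, vecMulVec_apply] <;> linarith
  refine ⟨t, ?_, hA⟩
  have h1 : (A * A).trace = ξ ^ 2 - 2 * t ^ 2 := by
    rw [hA]
    simp [Matrix.trace, Matrix.mul_apply, Fin.sum_univ_three, crossMatrix, vecMulVec_apply]
    linear_combination (ξ ^ 2 * (u 0 * u 0 + u 1 * u 1 + u 2 * u 2 + 1) - 2 * t ^ 2) * hu'
  linarith

lemma crossMatrix_smul (r : ℝ) (u : Fin 3 → ℝ) : crossMatrix (r • u) = r • crossMatrix u := by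
  ext i j
  fin_cases i <;> fin_cases j <;> simp [crossMatrix]

lemma smul_eq_of_sq {b c u v : Fin 3 → ℝ} (hu : u ⬝ᵥ u = 1) (hB : B = vecMulVec b v)
    (hC : C = vecMulVec c u) (hAu : A *ᵥ u = A.trace • u) (hsq : A * A + B * C = -1) :
    (v ⬝ᵥ c) • b = -(1 + A.trace ^ 2) • u := by
  have := congrArg (· *ᵥ u) hsq
  simp only [add_mulVec, ← mulVec_mulVec, hAu, mulVec_smul, hB, hC, vecMulVec_mulVec, hu] at this
  simp [neg_mulVec] at this
  rw [← sub_eq_zero] at this ⊢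
  rw [← this]
  ext i
  simp
  ring

theorem exists_parameters (h : BlockRel A B C D) (h' : BlockRel D C B A) :
    ∃ (ξ η : ℝ) (u v : Fin 3 → ℝ), η ≠ 0 ∧ u ⬝ᵥ u = 1 ∧ v ⬝ᵥ v = 1 ∧
      A = ξ • vecMulVec u u - crossMatrix u ∧ B = η • vecMulVec u v ∧
      C = -((ξ ^ 2 + 1) / η) • vecMulVec v u ∧ D = -ξ • vecMulVec v v - crossMatrix v := by
  obtain ⟨c, u, hu, hC, hAu, huA, hDc⟩ := h.exists_vecMulVec
  obtain ⟨b, v, hv, hB, hDv, hvD, hAb⟩ := h'.exists_vecMulVec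
  have hb : (v ⬝ᵥ c) • b = -(1 + A.trace ^ 2) • u := smul_eq_of_sq hu hB hC hAu h.sq_diag
  have hc : (u ⬝ᵥ b) • c = -(1 + D.trace ^ 2) • v := smul_eq_of_sq hv hC hB hDv h'.sq_diag
  have hBC : A * A = -1 + (1 + A.trace ^ 2) • vecMulVec u u := by
    rw [← h.sq_diag, hB, hC, vecMulVec_mul_vecMulVec, vecMulVec_smul, ← smul_vecMulVec, hb,
      smul_vecMulVec, neg_smul]
    abel
  have hCB : D * D = -1 + (1 + D.trace ^ 2) • vecMulVec v v := by
    rw [← h'.sq_diag, hB, hC, vecMulVec_mul_vecMulVec, vecMulVec_smul, ← smul_vecMulVec, hc,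
      smul_vecMulVec, neg_smul]
    abel
  obtain ⟨t, ht, hA⟩ := diag_block_eq hu h.diag hAu huA hBC
  obtain ⟨s, hs, hD⟩ := diag_block_eq hv h'.diag hDv hvD hCB
  have hvc : v ⬝ᵥ c ≠ 0 := by
    intro h0
    have := congrArg (u ⬝ᵥ ·) hb
    simp [h0, hu] at this
    nlinarith [sq_nonneg A.trace]
  obtain ⟨η, hη⟩ : ∃ η, b = η • u := by
    refine ⟨(v ⬝ᵥ c)⁻¹ * -(1 + A.trace ^ 2), ?_⟩
    rw [mul_smul, ← hb, smul_smul, inv_mul_cancel₀ hvc, one_smul]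
  have hη0 : η ≠ 0 := by
    rintro rfl
    have := congrArg (u ⬝ᵥ ·) hb
    simp [hη, hu] at this
    nlinarith [sq_nonneg A.trace]
  have htr : D.trace = -A.trace := by
    rw [hη, mulVec_smul, hAu, smul_smul, smul_smul] at hAb
    have := congrArg (u ⬝ᵥ ·) hAb
    simp only [dotProduct_smul, hu, smul_eq_mul, mul_one] at this
    have h0 : η * (D.trace + A.trace) = 0 := by linear_combination this
    linarith [(mul_eq_zero.mp h0).resolve_left hη0]
  have hc' : c = (-(1 + A.trace ^ 2) / η) • v := by
    rw [hη, dotProduct_smul, hu, smul_eq_mul, mul_one, htr, neg_sq] at hc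
    rw [div_eq_inv_mul, mul_smul, ← hc, smul_smul, inv_mul_cancel₀ hη0, one_smul]
  rw [htr] at hD
  have ht0 : t ≠ 0 := by rintro rfl; norm_num at ht
  have hs0 : s ≠ 0 := by rintro rfl; norm_num at hs
  refine ⟨A.trace, η * t * s, -t • u, -s • v, by simp [hη0, ht0, hs0], ?_, ?_, ?_, ?_, ?_, ?_⟩
  · simp [smul_dotProduct, dotProduct_smul, hu]
    linear_combination ht
  · simp [smul_dotProduct, dotProduct_smul, hv]
    linear_combination hs
  · rw [crossMatrix_smul, smul_vecMulVec, vecMulVec_smul, smul_smul, smul_smul]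
    nth_rewrite 1 [hA]
    rw [neg_smul, sub_neg_eq_add]
    congr 2
    linear_combination -A.trace * ht
  · rw [hB, hη, smul_vecMulVec, smul_vecMulVec, vecMulVec_smul, smul_smul, smul_smul]
    congr 1
    linear_combination -η * (s ^ 2 * ht + hs)
  · rw [hC, hc', smul_vecMulVec, smul_vecMulVec, vecMulVec_smul, smul_smul, smul_smul]
    congr 1
    field_simp
    ring
  · rw [crossMatrix_smul, smul_vecMulVec, vecMulVec_smul, smul_smul, smul_smul]
    nth_rewrite 1 [hD]
    rw [neg_smul (s), sub_neg_eq_add]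
    congr 2
    linear_combination A.trace * hs

lemma blockRel_of_isCx6 {J : Matrix (Fin 6) (Fin 6) ℝ} (hJ : isCx6 J) (f g : Fin 3 → Fin 6)
    (hfg : f = ![0, 1, 2] ∧ g = ![3, 4, 5] ∨ f = ![3, 4, 5] ∧ g = ![0, 1, 2]) :
    BlockRel (J.submatrix f f) (J.submatrix f g) (J.submatrix g f) (J.submatrix g g) := by
  obtain ⟨hsq, hT⟩ := hJ
  have hmul (X : Fin 6 → ℝ) : J *ᵥ X = fun k => J k 0 * X 0 + J k 1 * X 1 + J k 2 * X 2 +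
      J k 3 * X 3 + J k 4 * X 4 + J k 5 * X 5 := by
    ext k
    simp only [mulVec, dotProduct, Fin.sum_univ_six]
  have htor (k : Fin 6) (j : Fin 3) :=
    congrFun (hT (Pi.single (f (j + 1)) 1) (Pi.single (f (j + 2)) 1)) k
  simp only [hmul, bra6, Pi.sub_apply] at htor
  have hdiag (i j : Fin 3) := htor (f i) j
  have hoff (i j : Fin 3) := htor (g i) j
  have hsqf (i j : Fin 3) := congrFun (congrFun hsq (f i)) (f j)
  have hsqg (i j : Fin 3) := congrFun (congrFun hsq (g i)) (f j)
  clear htor hT hsq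
  rcases hfg with ⟨rfl, rfl⟩ | ⟨rfl, rfl⟩
  all_goals
    constructor <;> ext i j <;>
      simp only [adjugate_fin_three, Matrix.mul_apply, Matrix.add_apply, Matrix.sub_apply,
        Matrix.smul_apply, Matrix.transpose_apply, Matrix.submatrix_apply, Matrix.trace,
        Matrix.diag_apply, Matrix.one_apply, Fin.sum_univ_three, Fin.sum_univ_six] at hsqf hsqg ⊢
    · have := hdiag i j
      fin_cases i <;> fin_cases j <;> simp at this ⊢ <;> linear_combination this
    · have := hoff i j
      fin_cases i <;> fin_cases j <;> simp at this ⊢ <;> linear_combination this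
    · have := hsqf i j
      fin_cases i <;> fin_cases j <;> simp at this ⊢ <;> linear_combination this
    · have := hsqg i j
      fin_cases i <;> fin_cases j <;> simp at this ⊢ <;> linear_combination this

/-- The complex structure with parameters `ξ`, `η`, `K` and unit vectors `u`, `v`. -/
def paramMatrix (ξ η K : ℝ) (u v : Fin 3 → ℝ) : Matrix (Fin 6) (Fin 6) ℝ :=
  !![u 0 ^ 2 * ξ, u 0 * u 1 * ξ + u 2, u 0 * u 2 * ξ - u 1, η * u 0 * v 0, η * u 0 * v 1,
      η * u 0 * v 2;
    u 0 * u 1 * ξ - u 2, u 1 ^ 2 * ξ, u 1 * u 2 * ξ + u 0, η * u 1 * v 0, η * u 1 * v 1,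
      η * u 1 * v 2;
    u 0 * u 2 * ξ + u 1, u 1 * u 2 * ξ - u 0, u 2 ^ 2 * ξ, η * u 2 * v 0, η * u 2 * v 1,
      η * u 2 * v 2;
    -(K * u 0 * v 0), -(K * u 1 * v 0), -(K * u 2 * v 0), -(v 0 ^ 2 * ξ),
      -(v 0 * v 1 * ξ) + v 2, -(v 0 * v 2 * ξ) - v 1;
    -(K * u 0 * v 1), -(K * u 1 * v 1), -(K * u 2 * v 1), -(v 0 * v 1 * ξ) - v 2,
      -(v 1 ^ 2 * ξ), -(v 1 * v 2 * ξ) + v 0;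
    -(K * u 0 * v 2), -(K * u 1 * v 2), -(K * u 2 * v 2), -(v 0 * v 2 * ξ) + v 1,
      -(v 1 * v 2 * ξ) - v 0, -(v 2 ^ 2 * ξ)]

lemma eq_paramMatrix_of_isCx6 {J : Matrix (Fin 6) (Fin 6) ℝ} (hJ : isCx6 J) :
    ∃ (ξ η : ℝ) (u v : Fin 3 → ℝ), η ≠ 0 ∧ u ⬝ᵥ u = 1 ∧ v ⬝ᵥ v = 1 ∧
      J = paramMatrix ξ η ((ξ ^ 2 + 1) / η) u v := by
  obtain ⟨ξ, η, u, v, hη, hu, hv, hA, hB, hC, hD⟩ := exists_parameters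
    (blockRel_of_isCx6 hJ ![0, 1, 2] ![3, 4, 5] (Or.inl ⟨rfl, rfl⟩))
    (blockRel_of_isCx6 hJ ![3, 4, 5] ![0, 1, 2] (Or.inr ⟨rfl, rfl⟩))
  refine ⟨ξ, η, u, v, hη, hu, hv, ?_⟩
  rw [← Matrix.ext_iff] at hA hB hC hD
  simp [Fin.forall_fin_succ, crossMatrix, vecMulVec_apply] at hA hB hC hD
  ext i j
  fin_cases i <;> fin_cases j <;> simp [paramMatrix, *] <;> ring

lemma paramMatrix_mul_self {ξ η K : ℝ} {u v : Fin 3 → ℝ} (hu : u ⬝ᵥ u = 1) (hv : v ⬝ᵥ v = 1)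
    (hK : K * η = ξ ^ 2 + 1) : paramMatrix ξ η K u v * paramMatrix ξ η K u v = -1 := by
  simp only [dotProduct, Fin.sum_univ_three] at hu hv
  ext i j
  fin_cases i <;> fin_cases j <;>
    simp [paramMatrix, Matrix.mul_apply, Fin.sum_univ_six] <;> grind

lemma paramMatrix_mulVec (ξ η K : ℝ) (u v : Fin 3 → ℝ) (X : Fin 6 → ℝ) {a b : ℝ}
    (ha : a = u 0 * X 0 + u 1 * X 1 + u 2 * X 2) (hb : b = v 0 * X 3 + v 1 * X 4 + v 2 * X 5) :
    paramMatrix ξ η K u v *ᵥ X =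
      ![(ξ * a + η * b) * u 0 - (u 1 * X 2 - u 2 * X 1),
        (ξ * a + η * b) * u 1 - (u 2 * X 0 - u 0 * X 2),
        (ξ * a + η * b) * u 2 - (u 0 * X 1 - u 1 * X 0),
        -(K * a + ξ * b) * v 0 - (v 1 * X 5 - v 2 * X 4),
        -(K * a + ξ * b) * v 1 - (v 2 * X 3 - v 0 * X 5),
        -(K * a + ξ * b) * v 2 - (v 0 * X 4 - v 1 * X 3)] := by
  ext k
  fin_cases k <;> simp [paramMatrix, mulVec, dotProduct, Fin.sum_univ_six, ha, hb] <;> ring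

lemma torsion6_paramMatrix {ξ η K : ℝ} {u v : Fin 3 → ℝ} (hu : u ⬝ᵥ u = 1) (hv : v ⬝ᵥ v = 1) :
    torsion6 (paramMatrix ξ η K u v) := by
  simp only [dotProduct, Fin.sum_univ_three] at hu hv
  intro X Y
  obtain ⟨a, ha⟩ : ∃ a, a = u 0 * X 0 + u 1 * X 1 + u 2 * X 2 := ⟨_, rfl⟩
  obtain ⟨b, hb⟩ : ∃ b, b = v 0 * X 3 + v 1 * X 4 + v 2 * X 5 := ⟨_, rfl⟩
  obtain ⟨c, hc⟩ : ∃ c, c = u 0 * Y 0 + u 1 * Y 1 + u 2 * Y 2 := ⟨_, rfl⟩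
  obtain ⟨d, hd⟩ : ∃ d, d = v 0 * Y 3 + v 1 * Y 4 + v 2 * Y 5 := ⟨_, rfl⟩
  rw [sub_sub, ← mulVec_add, paramMatrix_mulVec ξ η K u v X ha hb,
    paramMatrix_mulVec ξ η K u v Y hc hd, paramMatrix_mulVec ξ η K u v _ (a := 0) (b := 0)]
  · ext k
    fin_cases k <;> simp [bra6]
    · linear_combination (X 1 * Y 2 - X 2 * Y 1) * hu
    · linear_combination (X 2 * Y 0 - X 0 * Y 2) * hu
    · linear_combination (X 0 * Y 1 - X 1 * Y 0) * hu
    · linear_combination (X 4 * Y 5 - X 5 * Y 4) * hv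
    · linear_combination (X 5 * Y 3 - X 3 * Y 5) * hv
    · linear_combination (X 3 * Y 4 - X 4 * Y 3) * hv
  · simp [bra6]
    ring
  · simp [bra6]
    ring

lemma isCx6_paramMatrix {ξ η : ℝ} {u v : Fin 3 → ℝ} (hη : η ≠ 0) (hu : u ⬝ᵥ u = 1)
    (hv : v ⬝ᵥ v = 1) : isCx6 (paramMatrix ξ η ((ξ ^ 2 + 1) / η) u v) :=
  ⟨paramMatrix_mul_self hu hv (div_mul_cancel₀ _ hη), torsion6_paramMatrix hu hv⟩

end SuTwo

/-- A 6×6 real matrix is a complex structure on su(2) ⊕ su(2) iff it has the explicit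
form (Xsu2xsu2) with ξ ∈ ℝ, η ≠ 0 and unit vectors (λ₁,μ₁,ν₁), (λ₂,μ₂,ν₂) ∈ S². -/
theorem stmt12 (J : Matrix (Fin 6) (Fin 6) ℝ) :
    isCx6 J ↔
      ∃ ξ η l1 m1 n1 l2 m2 n2 : ℝ, η ≠ 0 ∧
        l1 ^ 2 + m1 ^ 2 + n1 ^ 2 = 1 ∧ l2 ^ 2 + m2 ^ 2 + n2 ^ 2 = 1 ∧
        J = !![l1 ^ 2 * ξ, -(l1 * m1 * ξ) + n1, l1 * n1 * ξ + m1,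
                 η * l1 * l2, -(η * l1 * m2), η * l1 * n2;
               -(l1 * m1 * ξ) - n1, m1 ^ 2 * ξ, l1 - m1 * n1 * ξ,
                 -(η * m1 * l2), η * m1 * m2, -(η * m1 * n2);
               l1 * n1 * ξ - m1, -l1 - m1 * n1 * ξ, n1 ^ 2 * ξ,
                 η * n1 * l2, -(η * n1 * m2), η * n1 * n2;
               -((ξ ^ 2 + 1) / η * l1 * l2), (ξ ^ 2 + 1) / η * m1 * l2,
                 -((ξ ^ 2 + 1) / η * n1 * l2),
                 -(l2 ^ 2 * ξ), l2 * m2 * ξ + n2, -(l2 * n2 * ξ) + m2;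
               (ξ ^ 2 + 1) / η * l1 * m2, -((ξ ^ 2 + 1) / η * m1 * m2),
                 (ξ ^ 2 + 1) / η * n1 * m2,
                 l2 * m2 * ξ - n2, -(m2 ^ 2 * ξ), l2 + m2 * n2 * ξ;
               -((ξ ^ 2 + 1) / η * l1 * n2), (ξ ^ 2 + 1) / η * m1 * n2,
                 -((ξ ^ 2 + 1) / η * n1 * n2),
                 -(l2 * n2 * ξ) - m2, -l2 + m2 * n2 * ξ, -(n2 ^ 2 * ξ)] := by
  constructor
  · intro hJ
    obtain ⟨ξ, η, u, v, hη, hu, hv, rfl⟩ := SuTwo.eq_paramMatrix_of_isCx6 hJ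
    simp only [dotProduct, Fin.sum_univ_three] at hu hv
    refine ⟨ξ, η, u 0, -u 1, u 2, v 0, -v 1, v 2, hη, by linarith, by linarith, ?_⟩
    ext i j
    fin_cases i <;> fin_cases j <;> simp [SuTwo.paramMatrix] <;> ring
  · rintro ⟨ξ, η, l1, m1, n1, l2, m2, n2, hη, h1, h2, rfl⟩
    have hu : ![l1, -m1, n1] ⬝ᵥ ![l1, -m1, n1] = 1 := by
      simp [dotProduct, Fin.sum_univ_three]
      linarith
    have hv : ![l2, -m2, n2] ⬝ᵥ ![l2, -m2, n2] = 1 := by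
      simp [dotProduct, Fin.sum_univ_three]
      linarith
    convert SuTwo.isCx6_paramMatrix (ξ := ξ) hη hu hv using 1
    ext i j
    fin_cases i <;> fin_cases j <;> simp [SuTwo.paramMatrix] <;> ring
end
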